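/- Theorem 3.2 (recursion for the partition function at a simple reflection s_i, 1 ≤ i ≤ n−1): Assume 1 ≤ i ≤ n−1 and σ(i+1) > σ(i) (in the color order). Let s_i ∈ B_n be the transposition (i, i+1) and let s_i·x := (x_1,…,x_{i+1},x_i,…,x_n). Then q^{1+1_{σ(i+1)∈[n]}} · f_μ^{σ s_i}(x) = ((q−1)x_{i+1}/(x_{i+1}−x_i)) · q^{1_{σ(i)∈[n]}} · f_μ^σ(x) + ((x_{i+1}−q x_i)/(x_{i+1}−x_i)) · q^{1_{σ(i)∈[n]}} · f_μ^σ(s_i·x), provided x_i ≠ x_{i+1} and all denominators appearing in the weights are nonzero. -/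

import Mathlib

open scoped BigOperators

/-- The set of colors `{0} ∪ [±n]`, encoded as `Fin (2*n+1)`:
index `i < n` is the positive color `i+1`, index `n` is the color `0`,
and index `k > n` is the negative color `\overline{2*n+1-k}`.
The order on `Fin (2*n+1)` is exactly the color order
`1 < ⋯ < n < 0 < n̄ < ⋯ < 1̄`. -/
abbrev Col (n : ℕ) := Fin (2*n+1)

/-- The color `0` (identified with the `+` spin). -/
def mid (n : ℕ) : Col n := ⟨n, by omega⟩

/-- The bar involution `i ↦ ī` on colors (fixing `0`). -/
def barC (n : ℕ) (c : Col n) : Col n := ⟨2*n - c.val, by omega⟩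

/-- The positive color `i+1` attached to `i : Fin n`. -/
def posC (n : ℕ) (i : Fin n) : Col n := ⟨i.val, by have := i.isLt; omega⟩

/-- Vectors `I ∈ ℕ^{2n}` indexed by the colors `[±n]` (the entry at the
color `0` is irrelevant/always `0`). -/
abbrev Vec (n : ℕ) := Col n → ℕ

/-- `e_j`: the standard basis vector for `j ∈ [±n]`, and `e_0 = 0`. -/
def eV (n : ℕ) (c : Col n) : Vec n := fun k => if c ≠ mid n ∧ k = c then 1 else 0

/-- `I_{[1,n]}`. -/
def sLo (n : ℕ) (I : Vec n) : ℕ := ∑ k ∈ Finset.univ.filter (fun k : Col n => k < mid n), I k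
/-- `I_{[n̄,1̄]}`. -/
def sHi (n : ℕ) (I : Vec n) : ℕ := ∑ k ∈ Finset.univ.filter (fun k : Col n => mid n < k), I k
/-- `I_{≤ l}`. -/
def sLe (n : ℕ) (I : Vec n) (l : Col n) : ℕ := ∑ k ∈ Finset.univ.filter (fun k : Col n => k ≤ l), I k
/-- `I_{< l}`. -/
def sLt (n : ℕ) (I : Vec n) (l : Col n) : ℕ := ∑ k ∈ Finset.univ.filter (fun k : Col n => k < l), I k
/-- `I_{> l}`. -/
def sGt (n : ℕ) (I : Vec n) (l : Col n) : ℕ := ∑ k ∈ Finset.univ.filter (fun k : Col n => l < k), I k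
/-- `I_{≥ l}`. -/
def sGe (n : ℕ) (I : Vec n) (l : Col n) : ℕ := ∑ k ∈ Finset.univ.filter (fun k : Col n => l ≤ k), I k

/-- The Boltzmann weight `L_x(I, j, K, ℓ)` of a Γ vertex (Table 2.1). -/
noncomputable def LW (n : ℕ) (q s x : ℂ) (I : Vec n) (j : Col n) (K : Vec n) (l : Col n) : ℂ :=
  if ∀ k, I k + eV n j k = K k + eV n l k then
    if j = l then
      if l = mid n then (q ^ (-(sLo n I : ℤ)) - s * x * q ^ (sHi n I : ℤ)) / (1 - s * x)
      else if l < mid n then (s * q ^ (I l : ℤ) - x) * q ^ (-(sLe n I l : ℤ)) / (s * (1 - s * x))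
      else s * (s * q ^ (I l : ℤ) - x) * q ^ (sGt n I l : ℤ) / (1 - s * x)
    else if j < l then
      if l = mid n then (x * q ^ (-(sLo n I : ℤ)) - s ^ 2 * x * q ^ (sHi n I : ℤ)) / (s * (1 - s * x))
      else if l < mid n then -x * (1 - q ^ (I l : ℤ)) * q ^ (-(sLe n I l : ℤ)) / (s * (1 - s * x))
      else -(s * x) * (1 - q ^ (I l : ℤ)) * q ^ (sGt n I l : ℤ) / (1 - s * x)
    else
      if l = mid n then (q ^ (-(sLo n I : ℤ)) - s ^ 2 * q ^ (sHi n I : ℤ)) / (1 - s * x)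
      else if l < mid n then -(1 - q ^ (I l : ℤ)) * q ^ (-(sLe n I l : ℤ)) / (1 - s * x)
      else -(s ^ 2) * (1 - q ^ (I l : ℤ)) * q ^ (sGt n I l : ℤ) / (1 - s * x)
  else 0

/-- The Boltzmann weight `M_x(I, j, K, ℓ)` of a Δ vertex (Table 2.2). -/
noncomputable def MW (n : ℕ) (q s x : ℂ) (I : Vec n) (j : Col n) (K : Vec n) (l : Col n) : ℂ :=
  if ∀ k, I k + eV n j k = K k + eV n l k then
    if j = l then
      if l = mid n then (q ^ (-(sHi n I : ℤ)) - s * x * q ^ (sLo n I : ℤ)) / (1 - s * x)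
      else if l < mid n then s * (s * q ^ (I l : ℤ) - x) * q ^ (sLt n I l : ℤ) / (1 - s * x)
      else (1 - s⁻¹ * x * q ^ (-(I l : ℤ))) * q ^ (-(sGt n I l : ℤ)) / (1 - s * x)
    else if j < l then
      if l = mid n then (q ^ (-(sHi n I : ℤ)) - s ^ 2 * q ^ (sLo n I : ℤ)) / (1 - s * x)
      else if l < mid n then -(s ^ 2) * (1 - q ^ (I l : ℤ)) * q ^ (sLt n I l : ℤ) / (1 - s * x)
      else -(1 - q ^ (I l : ℤ)) * q ^ (-(sGe n I l : ℤ)) / (1 - s * x)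
    else
      if l = mid n then x * (s⁻¹ * q ^ (-(sHi n I : ℤ)) - s * q ^ (sLo n I : ℤ)) / (1 - s * x)
      else if l < mid n then -(s * x) * (1 - q ^ (I l : ℤ)) * q ^ (sLt n I l : ℤ) / (1 - s * x)
      else -(s⁻¹ * x) * (1 - q ^ (I l : ℤ)) * q ^ (-(sGe n I l : ℤ)) / (1 - s * x)
  else 0

/-- `φ(z) = (1-z²)/((1-νtz)(1+ν⁻¹z))`. -/
noncomputable def phiF (ν t z : ℂ) : ℂ := (1 - z ^ 2) / ((1 - ν * t * z) * (1 + ν⁻¹ * z))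

/-- The cap vertex Boltzmann weight `Cap_x(ε → ε')` (Figure 2.3), where `ε` is
the incoming bottom color and `ε'` the outgoing top color, and `qh` denotes the
fixed branch of `q^{-1/2}`. -/
noncomputable def capW (n : ℕ) (ν t qh x : ℂ) (ε ε' : Col n) : ℂ :=
  if ε = mid n ∧ ε' = mid n then 1
  else if ε < mid n ∧ ε' = barC n ε then t * phiF ν t (qh * x⁻¹)
  else if ε < mid n ∧ ε' = ε then 1 - t * phiF ν t (qh * x⁻¹)
  else if mid n < ε ∧ ε' = barC n ε then phiF ν t (qh * x⁻¹)
  else if mid n < ε ∧ ε' = ε then 1 - phiF ν t (qh * x⁻¹)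
  else 0

/-- A state of the model on the `2n × L` lattice: the first component assigns a
color to each horizontal edge (row `r : Fin (2n)`, 0-indexed top to bottom, and
horizontal position `p : Fin (L+1)`, with `p = 0` the right boundary and
`p = L` the left boundary; the vertex in the paper's column `c+1` of row `r+1`
lies between positions `c` (east) and `c+1` (west)); the second component
assigns a vector in `ℕ^{2n}` to each vertical edge (level `v : Fin (2n+1)`,
with `v = 0` the top boundary and `v = 2n` the bottom boundary, and column
`c : Fin L`, 0-indexed right to left). -/
abbrev St (n L : ℕ) := (Fin (2*n) × Fin (L+1) → Col n) × (Fin (2*n+1) × Fin L → Vec n)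

/-- The vector assigned at the top of column `c` (the paper's column `c+1`):
`∑_{i=1}^n (1_{μ_i = c+1} e_i + 1_{μ_i = -(c+1)} e_{ī})`. -/
def topV (n L : ℕ) (μ : Fin n → ℤ) (c : Fin L) : Vec n := fun k =>
  ∑ i : Fin n,
    ((if μ i = (c.val : ℤ) + 1 ∧ k = posC n i then 1 else 0) +
     (if μ i = -((c.val : ℤ) + 1) ∧ k = barC n (posC n i) then 1 else 0))

/-- The boundary conditions of the model with data `(σ, μ)`: on the left, the
paper's row `2i-1` (a Δ row, 0-indexed row `2i-2`, even) carries the color `0`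
and the paper's row `2i` (a Γ row, 0-indexed row `2i-1`, odd) carries the color
`σ(i)`; at the bottom every vertical edge carries the zero vector; at the top
the vertical edge in column `c` carries `topV μ c`. -/
def BC (n L : ℕ) (σ : Equiv.Perm (Col n)) (μ : Fin n → ℤ) (st : St n L) : Prop :=
  (∀ r : Fin (2*n), st.1 (r, Fin.last L) =
      if r.val % 2 = 0 then mid n
      else σ (posC n ⟨r.val / 2, by have := r.isLt; omega⟩)) ∧
  (∀ c : Fin L, st.2 (0, c) = topV n L μ c) ∧
  (∀ c : Fin L, st.2 (Fin.last (2*n), c) = fun _ => 0)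

/-- The Boltzmann weight of a state: the product of the weights of all the
Γ, Δ and cap vertices.  Even 0-indexed rows (the paper's odd rows `2i-1`) are
rows of Δ vertices and odd 0-indexed rows (the paper's even rows `2i`) are rows
of Γ vertices, both with spectral parameter `x i`; the cap with spectral
parameter `x i` joins the right end of the paper's row `2i` (incoming, bottom)
to the right end of the paper's row `2i-1` (outgoing, top).
Here `qh` denotes the fixed branch of `q^{-1/2}`. -/
noncomputable def stWt (n L : ℕ) (q s ν t qh : ℂ) (x : Fin n → ℂ) (st : St n L) : ℂ :=
  (∏ r : Fin (2*n), ∏ c : Fin L,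
    if r.val % 2 = 0 then
      MW n q s (x ⟨r.val / 2, by have := r.isLt; omega⟩)
        (st.2 (r.succ, c)) (st.1 (r, c.castSucc)) (st.2 (r.castSucc, c)) (st.1 (r, c.succ))
    else
      LW n q s (x ⟨r.val / 2, by have := r.isLt; omega⟩)
        (st.2 (r.succ, c)) (st.1 (r, c.succ)) (st.2 (r.castSucc, c)) (st.1 (r, c.castSucc)))
  * ∏ i : Fin n,
      capW n ν t qh (x i)
        (st.1 (⟨2 * i.val + 1, by have := i.isLt; omega⟩, 0))
        (st.1 (⟨2 * i.val, by have := i.isLt; omega⟩, 0))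

/-- The partition function `f_μ^σ(x)` of the colored stochastic vertex model
with U-turn boundary: the sum of the Boltzmann weights of all states satisfying
the boundary conditions (the weight of a non-admissible state is `0`, and only
finitely many states have nonzero weight, so this is a finite sum over the
admissible states). -/
noncomputable def pf (n L : ℕ) (q s ν t qh : ℂ) (x : Fin n → ℂ)
    (σ : Equiv.Perm (Col n)) (μ : Fin n → ℤ) : ℂ :=
  ∑ᶠ st ∈ {st : St n L | BC n L σ μ st}, stWt n L q s ν t qh x st

/-- The element `s_i ∈ B_n` (for paper indices `i, i+1`, here 0-indexed `i, i'`
with `i' = i+1`), viewed as the permutation of the colors swapping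
`i ↔ i+1` and `ī ↔ \overline{i+1}`. -/
def siB (n : ℕ) (i i' : Fin n) : Equiv.Perm (Col n) :=
  (Equiv.swap (posC n i) (posC n i')).trans
    (Equiv.swap (barC n (posC n i)) (barC n (posC n i')))

/-- The color `n` (the paper's largest positive color). -/
def lastCol (n : ℕ) : Col n := ⟨n - 1, by omega⟩

/-- The element `s_n ∈ B_n` with `s_n(n) = n̄` and `s_n(j) = j` for `j < n`,
viewed as the permutation of the colors swapping `n ↔ n̄`. -/
def snB (n : ℕ) : Equiv.Perm (Col n) :=
  Equiv.swap (lastCol n) (barC n (lastCol n))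

set_option linter.all false

/-- unnormalised Γ weight -/
noncomputable def wG (X : ℂ) (h : ℕ → ℂ) (j l : ℕ) : ℂ :=
  (if l ≤ j then 1 else X) * h l - (if l < j then 1 else X) * h (l+1)

/-- unnormalised Δ weight -/
noncomputable def wD (s2 X : ℂ) (h : ℕ → ℂ) (j l : ℕ) : ℂ :=
  (if j ≤ l then 1 else X) * (s2 / h (l+1)) - (if j < l then 1 else X) * (s2 / h l)

/-- change of the heights when a color `j` enters and a color `l` leaves -/
noncomputable def shH (q : ℂ) (h : ℕ → ℂ) (j l : ℕ) : ℕ → ℂ := fun k =>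
  h k * (if l < k then q else 1) * (if j < k then q⁻¹ else 1)

noncomputable def rStay (q X Y : ℂ) (a b : ℕ) : ℂ :=
  if a < b then (q-1)*X else if b < a then (q-1)*Y else q*X - Y
noncomputable def rSwap (q X Y : ℂ) (a b : ℕ) : ℂ :=
  if a < b then X-Y else if b < a then q*(X-Y) else 0

lemma gg_id (q X Y : ℂ) (hq : q ≠ 0) (h : ℕ → ℂ) (a b l m : ℕ) :
    rStay q X Y a b * (wG Y h a l * wG X (shH q h a l) b m)
     + rSwap q X Y a b * (wG Y h b l * wG X (shH q h b l) a m)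
    = (wG X h a l * wG Y (shH q h a l) b m) * rStay q X Y l m
     + (wG X h a m * wG Y (shH q h a m) b l) * rSwap q X Y m l := by
  simp only [wG, shH, rStay, rSwap, Nat.lt_succ_iff]
  rcases lt_trichotomy l m with hlm | hlm | hlm <;>
  rcases lt_trichotomy a b with h1' | h1' | h1' <;>
  rcases lt_trichotomy a l with h2' | h2' | h2' <;>
  rcases lt_trichotomy b l with h3' | h3' | h3' <;>
  first
  | (exfalso; omega)
  | (rcases lt_trichotomy a m with h4' | h4' | h4' <;>
     rcases lt_trichotomy b m with h5' | h5' | h5' <;>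
     first
     | (exfalso; omega)
     | (try subst hlm
        try subst h1'
        try subst h2'
        try subst h3'
        try subst h4'
        try subst h5'
        simp only [*, if_true, if_false, lt_irrefl, le_refl, not_lt_of_gt, not_le_of_gt, le_of_lt]
        try field_simp
        try ring))


noncomputable def sStay (q z : ℂ) (k m : ℕ) : ℂ :=
  if m < k then q*(1-q*z) else if k < m then 1-q*z else 0
noncomputable def sSwap (q z : ℂ) (k m : ℕ) : ℂ :=
  if m < k then q*((q-1)*z) else if k < m then q-1 else q*(1-z)

lemma dg_sum1 (q s2 X Y : ℂ) (hq : q ≠ 0) (h : ℕ → ℂ) (hh : ∀ k, h k ≠ 0) (c l K : ℕ) :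
    ∑ k ∈ Finset.range K, wD s2 Y h c k * wG X (shH q h c k) k l =
      (if c < K then 1 else Y) * (if l < K then 1 else q*X) *
        (h l * (if c < l then q⁻¹ else 1) - h (l+1) * (if c < l+1 then q⁻¹ else 1)) * (s2 / h K)
      - Y*q*X*(h l * (if c < l then q⁻¹ else 1) - h (l+1) * (if c < l+1 then q⁻¹ else 1))
          * (s2 / h 0)
      + (if c = l ∧ l < K then (q*X-1)*s2*(Y-q⁻¹) else 0) := by
  induction K with
  | zero => simp; ring
  | succ K ih =>
    rw [Finset.sum_range_succ, ih]
    have e1 := hh K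
    have e2 := hh (K+1)
    have e3 := hh l
    have e4 := hh (l+1)
    have e5 := hh 0
    simp only [wG, wD, shH, Nat.lt_succ_iff]
    rcases lt_trichotomy c K with h1 | h1 | h1 <;>
    rcases lt_trichotomy l K with h2 | h2 | h2 <;>
    rcases lt_trichotomy c l with h3 | h3 | h3 <;>
    first
    | (exfalso; omega)
    | (try subst h1
       try subst h2
       try subst h3
       simp only [*, if_true, if_false, lt_irrefl, le_refl, not_lt_of_gt, not_le_of_gt, le_of_lt,
         ne_of_lt, ne_of_gt, true_and, and_true, false_and, and_false]
       try field_simp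
       try ring)

lemma dg_sum2 (q s2 X Y : ℂ) (hq : q ≠ 0) (h : ℕ → ℂ) (hh : ∀ k, h k ≠ 0) (m e K : ℕ) :
    ∑ k ∈ Finset.range K, wG X h m k * wD s2 Y (shH q h m k) k e =
      - ((if K ≤ m then 1 else X) * (if K ≤ e then q⁻¹ else Y) *
        (s2 / h (e+1) * (if m < e+1 then q else 1) - s2 / h e * (if m < e then q else 1)) * h K)
      + q⁻¹ * (s2 / h (e+1) * (if m < e+1 then q else 1) - s2 / h e * (if m < e then q else 1))
          * h 0
      + (if m = e ∧ e < K then s2*(q⁻¹-Y)*(1-q*X) else 0) := by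
  induction K with
  | zero => simp
  | succ K ih =>
    rw [Finset.sum_range_succ, ih]
    have e1 := hh K
    have e2 := hh (K+1)
    have e3 := hh e
    have e4 := hh (e+1)
    have e5 := hh 0
    simp only [wG, wD, shH, Nat.lt_succ_iff, Nat.succ_le_iff]
    rcases lt_trichotomy m K with h1 | h1 | h1 <;>
    rcases lt_trichotomy e K with h2 | h2 | h2 <;>
    rcases lt_trichotomy m e with h3 | h3 | h3 <;>
    first
    | (exfalso; omega)
    | (try subst h1
       try subst h2
       try subst h3
       simp only [*, if_true, if_false, lt_irrefl, le_refl, not_lt_of_gt, not_le_of_gt, le_of_lt,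
         ne_of_lt, ne_of_gt, true_and, and_true, false_and, and_false]
       try field_simp
       try ring)

lemma sum_split3 (u : ℕ → ℂ) (A B C : ℂ) (m N : ℕ) (hm : m < N) :
    ∑ k ∈ Finset.range N, u k * (if m < k then A else if k < m then B else C) =
      B * (∑ k ∈ Finset.range m, u k)
      + C * ((∑ k ∈ Finset.range (m+1), u k) - ∑ k ∈ Finset.range m, u k)
      + A * ((∑ k ∈ Finset.range N, u k) - ∑ k ∈ Finset.range (m+1), u k) := by
  obtain ⟨d, rfl⟩ : ∃ d, N = m + 1 + d := ⟨N - (m+1), by omega⟩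
  clear hm
  induction d with
  | zero =>
    rw [add_zero, Finset.sum_range_succ, Finset.sum_range_succ]
    have : ∀ k ∈ Finset.range m, u k * (if m < k then A else if k < m then B else C) = B * u k := by
      intro k hk
      have := Finset.mem_range.1 hk
      rw [if_neg (by omega), if_pos this]; ring
    rw [Finset.sum_congr rfl this, ← Finset.mul_sum]
    simp; ring
  | succ d ih =>
    rw [← add_assoc, Finset.sum_range_succ, ih, Finset.sum_range_succ u (m+1+d), if_pos (by omega)]
    ring


set_option maxHeartbeats 2000000 in
lemma dg_id (q s2 X Y : ℂ) (hq : q ≠ 0) (h : ℕ → ℂ) (hh : ∀ k, h k ≠ 0) (N : ℕ) (h0 : h 0 = 1)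
    (hN : h N = s2) (c m e l : ℕ) (hc : c < N) (hm : m < N) (he : e < N) (hl : l < N) :
    wD s2 Y h c e * sStay q (s2*X*Y) e m * wG X (shH q h c e) m l
      + (if e = m then ∑ k ∈ Finset.range N,
          wD s2 Y h c k * wG X (shH q h c k) k l * sSwap q (s2*X*Y) k m else 0)
    = wG X h m l * sStay q (s2*X*Y) c l * wD s2 Y (shH q h m l) c e
      + (if l = c then ∑ k ∈ Finset.range N,
          wG X h m k * wD s2 Y (shH q h m k) k e * sSwap q (s2*X*Y) c k else 0) := by
  have hs2 : s2 ≠ 0 := hN ▸ hh N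
  have key1 : ∑ k ∈ Finset.range N,
          wD s2 Y h c k * wG X (shH q h c k) k l * sSwap q (s2*X*Y) k m = _ :=
    sum_split3 _ _ _ _ m N hm
  have key2 : ∑ k ∈ Finset.range N,
          wG X h m k * wD s2 Y (shH q h m k) k e * sSwap q (s2*X*Y) c k =
          ∑ k ∈ Finset.range N, wG X h m k * wD s2 Y (shH q h m k) k e * 
           (if c < k then q-1 else if k < c then q*((q-1)*(s2*X*Y)) else q*(1-(s2*X*Y))) := by
    refine Finset.sum_congr rfl fun k _ => ?_
    unfold sSwap
    congr 1
    split_ifs <;> first | rfl | omega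
  rw [sum_split3 _ _ _ _ c N hc] at key2
  simp only [dg_sum1 q s2 X Y hq h hh, hN, h0, hc, hl, if_true] at key1
  simp only [dg_sum2 q s2 X Y hq h hh, hN, h0, hm.not_ge, he.not_ge, he, if_false] at key2
  rw [key1, key2]
  clear key1 key2
  have e1 := hh c
  have e2 := hh (c+1)
  have e3 := hh m
  have e4 := hh (m+1)
  have e5 := hh e
  have e6 := hh (e+1)
  have e7 := hh l
  have e8 := hh (l+1)
  clear hc hm he hl h0 hN hh
  by_cases hem : e = m
  · subst hem
    by_cases hlc : l = c
    · subst hlc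
      simp only [wG, wD, shH, sStay, Nat.lt_succ_iff, Nat.succ_le_iff]
      rcases lt_trichotomy l e with h1 | h1 | h1 <;>
      (try subst h1
       simp only [*, if_true, if_false, lt_irrefl, le_refl, not_lt_of_gt, not_le_of_gt, le_of_lt,
         ne_of_lt, ne_of_gt, true_and, and_true, false_and, and_false]
       try field_simp
       try ring)
    · have hlc' : c ≠ l := fun h => hlc h.symm
      simp only [wG, wD, shH, sStay, Nat.lt_succ_iff, Nat.succ_le_iff, hlc, hlc', if_false, false_and]
      rcases lt_trichotomy l e with h1 | h1 | h1 <;>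
      rcases lt_trichotomy c l with h2 | h2 | h2 <;>
      rcases lt_trichotomy c e with h3 | h3 | h3 <;>
      first
      | (exfalso; omega)
      | (try subst h1
         try subst h2
         try subst h3
         simp only [*, if_true, if_false, lt_irrefl, le_refl, not_lt_of_gt, not_le_of_gt, le_of_lt,
           ne_of_lt, ne_of_gt, true_and, and_true, false_and, and_false]
         try field_simp
         try ring)
  · have hem' : m ≠ e := fun h => hem h.symm
    by_cases hlc : l = c
    · subst hlc
      simp only [wG, wD, shH, sStay, Nat.lt_succ_iff, Nat.succ_le_iff, hem, hem', if_false, false_and]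
      rcases lt_trichotomy l e with h1 | h1 | h1 <;>
      rcases lt_trichotomy m l with h2 | h2 | h2 <;>
      rcases lt_trichotomy m e with h3 | h3 | h3 <;>
      first
      | (exfalso; omega)
      | (try subst h1
         try subst h2
         try subst h3
         simp only [*, if_true, if_false, lt_irrefl, le_refl, not_lt_of_gt, not_le_of_gt, le_of_lt,
           ne_of_lt, ne_of_gt, true_and, and_true, false_and, and_false]
         try field_simp
         try ring)
    · simp only [wG, wD, shH, sStay, Nat.lt_succ_iff, Nat.succ_le_iff, hlc, hem, if_false]
      rcases lt_trichotomy l e with h1 | h1 | h1 <;>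
      rcases lt_trichotomy c l with h2 | h2 | h2 <;>
      rcases lt_trichotomy c e with h3 | h3 | h3 <;>
      rcases lt_trichotomy m e with h4 | h4 | h4 <;>
      first
      | (exfalso; omega)
      | (rcases lt_trichotomy m c with h5 | h5 | h5 <;>
         rcases lt_trichotomy m l with h6 | h6 | h6 <;>
         first
         | (exfalso; omega)
         | (try subst h1
            try subst h2
            try subst h3
            try subst h4
            try subst h5
            try subst h6
            simp only [*, if_true, if_false, lt_irrefl, le_refl, not_lt_of_gt, not_le_of_gt,
              le_of_lt, ne_of_lt, ne_of_gt, true_and, and_true, false_and, and_false]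
            try field_simp
            try ring))


lemma barC_barC (n : ℕ) (a : Col n) : barC n (barC n a) = a := by
  ext; simp only [barC]; omega
lemma barC_mid (n : ℕ) : barC n (mid n) = mid n := by
  ext; simp only [barC, mid]; omega

/-- one-particle functions -/
abbrev Fn1 (n : ℕ) (Ω : Type) := Col n → Ω → ℂ
/-- two-particle functions -/
abbrev Fn2 (n : ℕ) (Ω : Type) := Col n → Col n → Ω → ℂ

/-- operator acting on the second particle -/
def lift2 (n : ℕ) (Ω : Type) (A : Module.End ℂ (Fn1 n Ω)) : Module.End ℂ (Fn2 n Ω) where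
  toFun Φ := fun a => A (Φ a)
  map_add' Φ Ψ := by ext a b V; simp
  map_smul' r Φ := by ext a b V; simp

/-- operator acting on the first particle -/
def lift1 (n : ℕ) (Ω : Type) (A : Module.End ℂ (Fn1 n Ω)) : Module.End ℂ (Fn2 n Ω) where
  toFun Φ := fun a b V => A (fun a' => Φ a' b) a V
  map_add' Φ Ψ := by
    ext a b V
    exact congrFun (congrFun (A.map_add (fun a' => Φ a' b) (fun a' => Ψ a' b)) a) V
  map_smul' r Φ := by
    ext a b V
    exact congrFun (congrFun (A.map_smul r (fun a' => Φ a' b)) a) V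

/-- exchange of particles -/
def opP (n : ℕ) (Ω : Type) : Module.End ℂ (Fn2 n Ω) where
  toFun Φ := fun a b => Φ b a
  map_add' _ _ := rfl
  map_smul' _ _ := rfl

/-- combination of stay and swap -/
def opSS (n : ℕ) (Ω : Type) (u v : ℕ → ℕ → ℂ) : Module.End ℂ (Fn2 n Ω) where
  toFun Φ := fun a b V => u a b * Φ a b V + v a b * Φ b a V
  map_add' Φ Ψ := by ext a b V; simp; ring
  map_smul' r Φ := by ext a b V; simp; ring

/-- the Hecke generator `T'` -/
noncomputable def opT (n : ℕ) (Ω : Type) (q : ℂ) : Module.End ℂ (Fn2 n Ω) :=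
  opSS n Ω (fun a b => if b < a then q - 1 else if a < b then 0 else q)
    (fun a b => if b < a then 1 else if a < b then q else 0)

/-- the boundary generator -/
noncomputable def opE (n : ℕ) (Ω : Type) (t : ℂ) : Module.End ℂ (Fn1 n Ω) where
  toFun Φ := fun a V => (if a < mid n then t else if mid n < a then 1 else 0)
      * (Φ (barC n a) V - Φ a V)
  map_add' Φ Ψ := by funext a V; simp only [Pi.add_apply]; ring
  map_smul' r Φ := by funext a V; simp only [Pi.smul_apply, smul_eq_mul, RingHom.id_apply]; ring

lemma lift1_apply (n : ℕ) (Ω : Type) (A : Module.End ℂ (Fn1 n Ω)) (Φ : Fn2 n Ω) (a b : Col n)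
    (V : Ω) : lift1 n Ω A Φ a b V = A (fun a' => Φ a' b) a V := rfl
lemma lift2_apply (n : ℕ) (Ω : Type) (A : Module.End ℂ (Fn1 n Ω)) (Φ : Fn2 n Ω) (a b : Col n)
    (V : Ω) : lift2 n Ω A Φ a b V = A (Φ a) b V := rfl
lemma opP_apply (n : ℕ) (Ω : Type) (Φ : Fn2 n Ω) (a b : Col n) (V : Ω) :
    opP n Ω Φ a b V = Φ b a V := rfl
lemma opSS_apply (n : ℕ) (Ω : Type) (u v : ℕ → ℕ → ℂ) (Φ : Fn2 n Ω) (a b : Col n) (V : Ω) :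
    opSS n Ω u v Φ a b V = u a b * Φ a b V + v a b * Φ b a V := rfl
lemma opE_apply (n : ℕ) (Ω : Type) (t : ℂ) (Φ : Fn1 n Ω) (a : Col n) (V : Ω) :
    opE n Ω t Φ a V = (if a < mid n then t else if mid n < a then 1 else 0)
      * (Φ (barC n a) V - Φ a V) := rfl

lemma lift1_mul (n : ℕ) (Ω : Type) (A B : Module.End ℂ (Fn1 n Ω)) :
    lift1 n Ω (A * B) = lift1 n Ω A * lift1 n Ω B := rfl
lemma lift2_mul (n : ℕ) (Ω : Type) (A B : Module.End ℂ (Fn1 n Ω)) :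
    lift2 n Ω (A * B) = lift2 n Ω A * lift2 n Ω B := rfl
lemma lift1_P (n : ℕ) (Ω : Type) (A : Module.End ℂ (Fn1 n Ω)) :
    lift1 n Ω A * opP n Ω = opP n Ω * lift2 n Ω A := rfl

lemma opT_sq (n : ℕ) (Ω : Type) (q : ℂ) :
    opT n Ω q * opT n Ω q = (q-1) • opT n Ω q + q • 1 := by
  refine LinearMap.ext fun Φ => ?_
  funext a b V
  simp only [opT, opSS_apply, Module.End.mul_apply, LinearMap.add_apply,
    LinearMap.smul_apply, Module.End.one_apply, Pi.add_apply, Pi.smul_apply, smul_eq_mul]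
  rcases lt_trichotomy (a:ℕ) b with h | h | h
  · simp [h, not_lt_of_gt h]
    try ring
  · have : a = b := Fin.ext h
    subst this; simp; ring
  · simp [h, not_lt_of_gt h]
    try ring

lemma opE_sq (n : ℕ) (Ω : Type) (t : ℂ) :
    opE n Ω t * opE n Ω t = (-(1+t)) • opE n Ω t := by
  refine LinearMap.ext fun Φ => ?_
  funext a V
  simp only [opE_apply, Module.End.mul_apply,
    LinearMap.smul_apply, Pi.smul_apply, smul_eq_mul, barC_barC]
  rcases lt_trichotomy a (mid n) with h | h | h
  · have h2 : mid n < barC n a := by simp only [Fin.lt_def, barC, mid] at *; omega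
    simp [h, h2, not_lt_of_gt h2]; ring
  · subst h; simp
  · have h2 : barC n a < mid n := by simp only [Fin.lt_def, barC, mid] at *; omega
    simp [h, h2, not_lt_of_gt h]; ring

lemma opTE (n : ℕ) (Ω : Type) (q t : ℂ) :
    opT n Ω q * lift2 n Ω (opE n Ω t) * opT n Ω q * lift2 n Ω (opE n Ω t)
     - lift2 n Ω (opE n Ω t) * opT n Ω q * lift2 n Ω (opE n Ω t) * opT n Ω q
     = (-(t*(q-1))) • (opT n Ω q * lift2 n Ω (opE n Ω t) - lift2 n Ω (opE n Ω t) * opT n Ω q) := by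
  refine LinearMap.ext fun Φ => ?_
  funext a b V
  simp only [opT, opE_apply, opSS_apply, lift2_apply, Module.End.mul_apply,
    LinearMap.sub_apply, Pi.sub_apply,
    LinearMap.smul_apply, Pi.smul_apply, smul_eq_mul, barC_barC, ← Fin.lt_def]
  have b1 : (barC n a < b) = (barC n b < a) := by
    simp only [Fin.lt_def, barC, eq_iff_iff]; omega
  have b2 : (b < barC n a) = (a < barC n b) := by
    simp only [Fin.lt_def, barC, eq_iff_iff]; omega
  have b3 : (barC n a < barC n b) = (b < a) := by
    simp only [Fin.lt_def, barC, eq_iff_iff]; omega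
  have b4 : (barC n b < barC n a) = (a < b) := by
    simp only [Fin.lt_def, barC, eq_iff_iff]; omega
  have b5 : (barC n a < mid n) = (mid n < a) := by
    simp only [Fin.lt_def, barC, mid, eq_iff_iff]; omega
  have b6 : (mid n < barC n a) = (a < mid n) := by
    simp only [Fin.lt_def, barC, mid, eq_iff_iff]; omega
  have b7 : (barC n b < mid n) = (mid n < b) := by
    simp only [Fin.lt_def, barC, mid, eq_iff_iff]; omega
  have b8 : (mid n < barC n b) = (b < mid n) := by
    simp only [Fin.lt_def, barC, mid, eq_iff_iff]; omega
  simp only [b1, b2, b3, b4, b5, b6, b7, b8]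
  clear b1 b2 b3 b4 b5 b6 b7 b8
  rcases lt_trichotomy a (mid n) with h1 | h1 | h1 <;>
  rcases lt_trichotomy b (mid n) with h2 | h2 | h2 <;>
  rcases lt_trichotomy a b with h3 | h3 | h3 <;>
  rcases lt_trichotomy a (barC n b) with h4 | h4 | h4 <;>
  first
  | (exfalso; simp only [Fin.lt_def, Fin.ext_iff, barC, mid] at *; omega)
  | (have n1 := not_lt_of_gt h1
     have n2 := not_lt_of_gt h2
     have n3 := not_lt_of_gt h3
     have n4 := not_lt_of_gt h4
     simp only [h1, h2, h3, h4, n1, n2, n3, n4, if_true, if_false]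
     ring)
  | (try have n1 := not_lt_of_gt h1
     try have n2 := not_lt_of_gt h2
     try have n3 := not_lt_of_gt h3
     try have n4 := not_lt_of_gt h4
     try subst h1
     try subst h2
     try subst h3
     try subst h4
     try simp only [barC_mid] at *
     try simp only [h1, n1, if_true, if_false]
     try simp only [h2, n2, if_true, if_false]
     try simp only [h3, n3, if_true, if_false]
     try simp only [h4, n4, if_true, if_false]
     try simp only [if_true, if_false, lt_irrefl, barC_barC, barC_mid]
     try ring)


set_option maxHeartbeats 2000000 in
lemma dd_id (q s2 X Y : ℂ) (hq : q ≠ 0) (h : ℕ → ℂ) (a b l m : ℕ) :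
    rStay q X Y b a * (wD s2 Y h a l * wD s2 X (shH q h a l) b m)
     + rSwap q X Y b a * (wD s2 Y h b l * wD s2 X (shH q h b l) a m)
    = (wD s2 X h a l * wD s2 Y (shH q h a l) b m) * rStay q X Y m l
     + (wD s2 X h a m * wD s2 Y (shH q h a m) b l) * rSwap q X Y l m := by
  simp only [wD, shH, rStay, rSwap, div_eq_mul_inv, mul_inv, apply_ite (fun z : ℂ => z⁻¹), inv_inv,
    inv_one, Nat.lt_succ_iff]
  obtain ⟨g, hg⟩ : ∃ g : ℕ → ℂ, ∀ k, (h k)⁻¹ = g k := ⟨fun k => (h k)⁻¹, fun _ => rfl⟩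
  simp only [hg]
  clear hg h
  rcases lt_trichotomy l m with hlm | hlm | hlm <;>
  rcases lt_trichotomy a b with h1' | h1' | h1' <;>
  rcases lt_trichotomy a l with h2' | h2' | h2' <;>
  rcases lt_trichotomy b l with h3' | h3' | h3' <;>
  first
  | (exfalso; omega)
  | (rcases lt_trichotomy a m with h4' | h4' | h4' <;>
     rcases lt_trichotomy b m with h5' | h5' | h5' <;>
     first
     | (exfalso; omega)
     | (try subst hlm
        try subst h1'
        try subst h2'
        try subst h3'
        try subst h4'
        try subst h5'
        simp only [*, if_true, if_false, lt_irrefl, le_refl, not_lt_of_gt, not_le_of_gt, le_of_lt]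
        try field_simp
        try ring))


lemma refl_abs {A : Type*} [Ring A] [Algebra ℂ A] (T E : A) (q t α β γ δ φ ψ : ℂ)
    (hT : T * T = (q-1) • T + q • (1:A)) (hE : E * E = (-(1+t)) • E)
    (hTE : T * E * T * E - E * T * E * T = (-(t*(q-1))) • (T * E - E * T))
    (hk : (q-1)*α*γ*φ + α*δ*φ + α*δ*ψ - (1+t)*α*δ*ψ*φ + β*γ*φ - β*γ*ψ = t*(q-1)*α*γ*ψ*φ) :
    (α • T + β • (1:A)) * (1 + ψ • E) * (γ • T + δ • (1:A)) * (1 + φ • E)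
     = (1 + φ • E) * (γ • T + δ • (1:A)) * (1 + ψ • E) * (α • T + β • (1:A)) := by
  have h1 : T * T * E = (q-1) • (T * E) + q • E := by rw [hT]; simp [add_mul]
  have h2 : E * T * T = (q-1) • (E * T) + q • E := by rw [mul_assoc, hT]; simp [mul_add]
  have h3 : T * E * E = (-(1+t)) • (T * E) := by rw [mul_assoc, hE]; simp
  have h4 : E * E * T = (-(1+t)) • (E * T) := by rw [hE]; simp
  have h5 : T * E * T * E = E * T * E * T + (-(t*(q-1))) • (T * E - E * T) := by
    rw [← hTE]; abel
  simp only [add_mul, mul_add, smul_mul_assoc, mul_smul_comm, one_mul, mul_one, ← mul_assoc,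
    h1, h2, h3, h4, h5, hT, hE, smul_add, smul_sub, smul_smul]
  rw [← sub_eq_zero]
  have hz : ((q-1)*α*γ*φ + α*δ*φ + α*δ*ψ - (1+t)*α*δ*ψ*φ + β*γ*φ - β*γ*ψ - t*(q-1)*α*γ*ψ*φ)
    • (T * E - E * T) = 0 := by rw [hk]; simp
  rw [← hz]
  module

lemma refl_scalar (q t ν qh x y : ℂ) (hq : q ≠ 0) (hν : ν ≠ 0) (hqh : qh ^ 2 * q = 1)
    (hx : x ≠ 0) (hy : y ≠ 0)
    (hx1 : 1 - ν * t * (qh * x⁻¹) ≠ 0) (hx2 : 1 + ν⁻¹ * (qh * x⁻¹) ≠ 0)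
    (hy1 : 1 - ν * t * (qh * y⁻¹) ≠ 0) (hy2 : 1 + ν⁻¹ * (qh * y⁻¹) ≠ 0) :
    (q-1)*(x-y)*(1-q*x*y)*phiF ν t (qh*x⁻¹) + (x-y)*((q-1)*(q*x*y))*phiF ν t (qh*x⁻¹)
      + (x-y)*((q-1)*(q*x*y))*phiF ν t (qh*y⁻¹)
      - (1+t)*(x-y)*((q-1)*(q*x*y))*phiF ν t (qh*y⁻¹)*phiF ν t (qh*x⁻¹)
      + ((q-1)*y)*(1-q*x*y)*phiF ν t (qh*x⁻¹) - ((q-1)*y)*(1-q*x*y)*phiF ν t (qh*y⁻¹)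
     = t*(q-1)*(x-y)*(1-q*x*y)*phiF ν t (qh*y⁻¹)*phiF ν t (qh*x⁻¹) := by
  have hqh0 : qh ≠ 0 := by rintro rfl; simp at hqh
  have hq' : q = (qh^2)⁻¹ := by field_simp; linear_combination hqh
  simp only [phiF]
  generalize hu : qh * x⁻¹ = u at *
  generalize hv : qh * y⁻¹ = v at *
  have hu0 : u ≠ 0 := by rw [← hu]; positivity
  have hv0 : v ≠ 0 := by rw [← hv]; positivity
  have ex : x = qh * u⁻¹ := by rw [← hu]; field_simp
  have ey : y = qh * v⁻¹ := by rw [← hv]; field_simp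
  have e1 : ν + u ≠ 0 := by
    intro h; apply hx2; field_simp; simpa using h
  have e2 : ν + v ≠ 0 := by
    intro h; apply hy2; field_simp; simpa using h
  rw [ex, ey, hq']
  have : (1 + ν⁻¹ * u) = (ν + u)/ν := by field_simp
  rw [this]
  have : (1 + ν⁻¹ * v) = (ν + v)/ν := by field_simp
  rw [this]
  obtain ⟨w, hw⟩ : ∃ w, ν * t = w := ⟨_, rfl⟩
  have ht : t = w * ν⁻¹ := by rw [← hw]; field_simp
  rw [hw] at hx1 hy1
  have hx1' : 1 - u * w ≠ 0 := by rwa [mul_comm]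
  have hy1' : 1 - v * w ≠ 0 := by rwa [mul_comm]
  rw [hw, ht]
  field_simp
  ring


/-- integer version of `eV` -/
def eZ (n : ℕ) (a : Col n) : Col n → ℤ := fun k => if a ≠ mid n ∧ k = a then 1 else 0

/-- heights attached to a vertical edge -/
noncomputable def HH (n : ℕ) (q s2 : ℂ) (I : Col n → ℤ) (k : ℕ) : ℂ :=
  if k ≤ n then q ^ (-(∑ j ∈ Finset.univ.filter (fun j : Col n => j.val < k), I j))
  else s2 * q ^ (∑ j ∈ Finset.univ.filter (fun j : Col n => k ≤ j.val), I j)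

lemma HH_zero (n : ℕ) (q s2 : ℂ) (I : Col n → ℤ) : HH n q s2 I 0 = 1 := by
  simp [HH]

lemma HH_last (n : ℕ) (q s2 : ℂ) (I : Col n → ℤ) : HH n q s2 I (2*n+1) = s2 := by
  have h1 : ¬ (2*n+1 ≤ n) := by omega
  have h2 : Finset.univ.filter (fun j : Col n => 2*n+1 ≤ j.val) = ∅ := by
    ext j; simp; omega
  rw [HH, if_neg h1, h2]; simp

lemma HH_ne (n : ℕ) (q s2 : ℂ) (hq : q ≠ 0) (hs : s2 ≠ 0) (I : Col n → ℤ) (k : ℕ) :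
    HH n q s2 I k ≠ 0 := by
  unfold HH
  split_ifs
  · exact zpow_ne_zero _ hq
  · exact mul_ne_zero hs (zpow_ne_zero _ hq)

lemma sum_eZ (n : ℕ) (a : Col n) (p : Col n → Prop) [DecidablePred p] :
    ∑ j ∈ Finset.univ.filter p, eZ n a j = if a ≠ mid n ∧ p a then 1 else 0 := by
  simp only [eZ, Finset.sum_filter]
  rw [Finset.sum_eq_single a]
  · by_cases h : p a <;> simp [h]
  · intro b _ hb; simp [hb]
  · simp

lemma HH_shift (n : ℕ) (q s2 : ℂ) (hq : q ≠ 0) (I : Col n → ℤ) (a l : Col n) :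
    HH n q s2 (I + (eZ n a - eZ n l)) = shH q (HH n q s2 I) a l := by
  funext k
  have key : ∀ p : Col n → Prop, ∀ [DecidablePred p],
      ∑ j ∈ Finset.univ.filter p, (I + (eZ n a - eZ n l)) j
      = ∑ j ∈ Finset.univ.filter p, I j + ((if a ≠ mid n ∧ p a then 1 else 0)
        - (if l ≠ mid n ∧ p l then 1 else 0)) := by
    intro p _
    simp only [Pi.add_apply, Pi.sub_apply, Finset.sum_add_distrib, Finset.sum_sub_distrib, sum_eZ]
  unfold HH shH
  by_cases hk : k ≤ n
  · have e : ∀ b : Col n, (b ≠ mid n ∧ b.val < k) = (b.val < k) := by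
      intro b; simp only [ne_eq, mid, Fin.ext_iff, eq_iff_iff]; omega
    simp only [hk, if_true, key, e]
    by_cases h1 : a.val < k <;> by_cases h2 : l.val < k <;>
      simp only [h1, h2, if_true, if_false, neg_add, zpow_add₀ hq] <;> simp <;> field_simp
  · have e : ∀ b : Col n, (b ≠ mid n ∧ k ≤ b.val) = (¬ b.val < k) := by
      intro b; simp only [ne_eq, mid, Fin.ext_iff, eq_iff_iff]; omega
    simp only [hk, if_false, key, e]
    by_cases h1 : a.val < k <;> by_cases h2 : l.val < k <;>
      simp only [h1, h2, not_true, not_false_iff, if_true, if_false, zpow_add₀ hq] <;>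
      simp <;> field_simp

/-- Γ weight with integer entries -/
noncomputable def gw (n : ℕ) (q s x : ℂ) (I : Col n → ℤ) (j l : Col n) : ℂ :=
  wG (x/s) (HH n q (s^2) I) j l / (1 - s*x)

/-- Δ weight with integer entries -/
noncomputable def dw (n : ℕ) (q s x : ℂ) (I : Col n → ℤ) (j l : Col n) : ℂ :=
  wD (s^2) (x/s) (HH n q (s^2) I) j l / (1 - s*x)

/-- cast of a vector -/
def castV (n : ℕ) (I : Vec n) : Col n → ℤ := fun k => (I k : ℤ)

lemma sLe_eq (n : ℕ) (I : Vec n) (l : Col n) : sLe n I l = I l + sLt n I l := by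
  unfold sLe sLt
  have : Finset.univ.filter (fun k : Col n => k ≤ l)
      = insert l (Finset.univ.filter (fun k : Col n => k < l)) := by
    ext k; simp [le_iff_eq_or_lt]
  rw [this, Finset.sum_insert (by simp)]

lemma sGe_eq (n : ℕ) (I : Vec n) (l : Col n) : sGe n I l = I l + sGt n I l := by
  unfold sGe sGt
  have : Finset.univ.filter (fun k : Col n => l ≤ k)
      = insert l (Finset.univ.filter (fun k : Col n => l < k)) := by
    ext k; simp [le_iff_eq_or_lt, eq_comm]
  rw [this, Finset.sum_insert (by simp)]

lemma HH_lo (n : ℕ) (q s2 : ℂ) (I : Vec n) (l : Col n) (hl : l ≤ mid n) :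
    HH n q s2 (castV n I) l = q ^ (-(sLt n I l : ℤ)) := by
  have : l.val ≤ n := by simpa [mid, Fin.le_def] using hl
  simp only [HH, this, if_true, castV, sLt, Fin.lt_def]
  push_cast; rfl

lemma HH_lo' (n : ℕ) (q s2 : ℂ) (I : Vec n) (l : Col n) (hl : l < mid n) :
    HH n q s2 (castV n I) (l.val+1) = q ^ (-(sLe n I l : ℤ)) := by
  have : l.val + 1 ≤ n := by simpa [mid, Fin.lt_def] using hl
  simp only [HH, this, if_true, castV, sLe, Fin.le_def, Nat.lt_succ_iff]
  push_cast; rfl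

lemma HH_hi (n : ℕ) (q s2 : ℂ) (I : Vec n) (l : Col n) (hl : mid n < l) :
    HH n q s2 (castV n I) l = s2 * q ^ (sGe n I l : ℤ) := by
  have : ¬ l.val ≤ n := by simpa [mid, Fin.lt_def] using hl
  simp only [HH, this, if_false, castV, sGe, Fin.le_def]
  push_cast; rfl

lemma HH_hi' (n : ℕ) (q s2 : ℂ) (I : Vec n) (l : Col n) (hl : mid n ≤ l) :
    HH n q s2 (castV n I) (l.val+1) = s2 * q ^ (sGt n I l : ℤ) := by
  have : ¬ l.val + 1 ≤ n := by
    have : n ≤ l.val := by simpa [mid, Fin.le_def] using hl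
    omega
  simp only [HH, this, if_false, castV, sGt, Fin.lt_def, Nat.succ_le_iff]
  push_cast; rfl

lemma sLo_eq (n : ℕ) (I : Vec n) : sLo n I = sLt n I (mid n) := rfl
lemma sHi_eq (n : ℕ) (I : Vec n) : sHi n I = sGt n I (mid n) := rfl

lemma q_sLt (n : ℕ) (q : ℂ) (hq : q ≠ 0) (I : Vec n) (l : Col n) :
    q ^ (-(sLt n I l : ℤ)) = q ^ (I l : ℤ) * q ^ (-(sLe n I l : ℤ)) := by
  rw [← zpow_add₀ hq, sLe_eq]; congr 1; push_cast; ring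
lemma q_sGe (n : ℕ) (q : ℂ) (hq : q ≠ 0) (I : Vec n) (l : Col n) :
    q ^ (sGe n I l : ℤ) = q ^ (I l : ℤ) * q ^ (sGt n I l : ℤ) := by
  rw [← zpow_add₀ hq, sGe_eq]; congr 1

lemma LW_eq (n : ℕ) (q s x : ℂ) (hq : q ≠ 0) (hs : s ≠ 0) (I : Vec n) (j : Col n)
    (K : Vec n) (l : Col n) :
    LW n q s x I j K l =
      if ∀ k, I k + eV n j k = K k + eV n l k then gw n q s x (castV n I) j l else 0 := by
  unfold LW gw wG
  refine if_congr Iff.rfl ?_ rfl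
  simp only [← Fin.lt_def, ← Fin.le_def, div_eq_mul_inv, mul_inv]
  generalize (1 - s*x)⁻¹ = D
  rcases lt_trichotomy l (mid n) with h | h | h
  · simp only [h, h.ne, HH_lo n q _ I l h.le, HH_lo' n q _ I l h, if_false, if_true,
      q_sLt n q hq I l]
    generalize q ^ (I l : ℤ) = A
    generalize q ^ (-(sLe n I l : ℤ)) = B
    rcases lt_trichotomy j l with h' | h' | h'
    · simp only [h', h'.ne, not_lt_of_gt h', not_le_of_gt h', if_false, if_true]; ring
    · subst h'; simp only [lt_irrefl, le_refl, if_false, if_true]; field_simp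
    · simp only [h', h'.ne', h'.le, not_lt_of_gt h', if_false, if_true]; ring
  · subst h
    simp only [HH_lo n q _ I _ le_rfl, HH_hi' n q _ I _ le_rfl, if_false, if_true, sLo_eq, sHi_eq]
    rcases lt_trichotomy j (mid n) with h' | h' | h'
    · simp only [h', h'.ne, not_lt_of_gt h', not_le_of_gt h', if_false, if_true]; ring
    · subst h'; simp only [lt_irrefl, le_refl, if_false, if_true]; field_simp
    · simp only [h', h'.ne', h'.le, not_lt_of_gt h', if_false, if_true]; ring
  · simp only [not_lt_of_gt h, h.ne', HH_hi n q _ I l h, HH_hi' n q _ I l h.le, if_false, if_true,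
      q_sGe n q hq I l]
    generalize q ^ (I l : ℤ) = A
    generalize q ^ (sGt n I l : ℤ) = B
    rcases lt_trichotomy j l with h' | h' | h'
    · simp only [h', h'.ne, not_lt_of_gt h', not_le_of_gt h', if_false, if_true]; field_simp; ring
    · subst h'; simp only [lt_irrefl, le_refl, if_false, if_true]; field_simp
    · simp only [h', h'.ne', h'.le, not_lt_of_gt h', if_false, if_true]; ring

lemma MW_eq (n : ℕ) (q s x : ℂ) (hq : q ≠ 0) (hs : s ≠ 0) (I : Vec n) (j : Col n)
    (K : Vec n) (l : Col n) :
    MW n q s x I j K l =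
      if ∀ k, I k + eV n j k = K k + eV n l k then dw n q s x (castV n I) j l else 0 := by
  unfold MW dw wD
  refine if_congr Iff.rfl ?_ rfl
  simp only [← Fin.lt_def, ← Fin.le_def, div_eq_mul_inv, mul_inv]
  generalize (1 - s*x)⁻¹ = D
  rcases lt_trichotomy l (mid n) with h | h | h
  · simp only [h, h.ne, HH_lo n q _ I l h.le, HH_lo' n q _ I l h, if_false, if_true,
      sLe_eq, Nat.cast_add, zpow_neg, inv_inv, zpow_add₀ hq]
    generalize q ^ (I l : ℤ) = A
    generalize q ^ (sLt n I l : ℤ) = B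
    rcases lt_trichotomy j l with h' | h' | h'
    · simp only [h', h'.ne, h'.le, if_false, if_true]; ring
    · subst h'; simp only [lt_irrefl, le_refl, if_false, if_true]; field_simp
    · simp only [h', h'.ne', not_le_of_gt h', not_lt_of_gt h', if_false, if_true]; field_simp; ring
  · subst h
    simp only [HH_lo n q _ I _ le_rfl, HH_hi' n q _ I _ le_rfl, if_false, if_true, sLo_eq, sHi_eq,
      zpow_neg, inv_inv, mul_inv]
    generalize q ^ (sLt n I (mid n) : ℤ) = A
    generalize (q ^ (sGt n I (mid n) : ℤ))⁻¹ = B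
    rcases lt_trichotomy j (mid n) with h' | h' | h'
    · simp only [h', h'.ne, h'.le, if_false, if_true]; field_simp
    · subst h'; simp only [lt_irrefl, le_refl, if_false, if_true]; field_simp
    · simp only [h', h'.ne', not_le_of_gt h', not_lt_of_gt h', if_false, if_true]; field_simp
  · have hA : q ^ (I l : ℤ) ≠ 0 := zpow_ne_zero _ hq
    simp only [not_lt_of_gt h, h.ne', HH_hi n q _ I l h, HH_hi' n q _ I l h.le, if_false, if_true,
      sGe_eq, Nat.cast_add, zpow_neg, inv_inv, zpow_add₀ hq, mul_inv]
    generalize q ^ (I l : ℤ) = A at *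
    generalize (q ^ (sGt n I l : ℤ))⁻¹ = B
    rcases lt_trichotomy j l with h' | h' | h'
    · simp only [h', h'.ne, h'.le, if_false, if_true]; field_simp; ring
    · subst h'; simp only [lt_irrefl, le_refl, if_false, if_true]; field_simp
    · simp only [h', h'.ne', not_le_of_gt h', not_lt_of_gt h', if_false, if_true]; field_simp; ring


/-- integer vertical configurations -/
abbrev VS (n : ℕ) := ℕ → Col n → ℤ

/-- change of the vertical configuration in column `c` -/
def sg (n : ℕ) (c : ℕ) (a l : Col n) : VS n := Pi.single c (eZ n a - eZ n l)

/-- one vertex operator -/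
noncomputable def rOp (n : ℕ) (w : (Col n → ℤ) → Col n → Col n → ℂ) (c : ℕ) :
    Module.End ℂ (Fn1 n (VS n)) where
  toFun Φ := fun a V => ∑ l, w (V c) a l * Φ l (V + sg n c a l)
  map_add' Φ Ψ := by
    funext a V; simp only [Pi.add_apply, mul_add, Finset.sum_add_distrib]
  map_smul' r Φ := by
    funext a V
    simp only [Pi.smul_apply, smul_eq_mul, RingHom.id_apply, Finset.mul_sum]
    exact Finset.sum_congr rfl fun l _ => by ring

lemma rOp_apply (n : ℕ) (w : (Col n → ℤ) → Col n → Col n → ℂ) (c : ℕ) (Φ : Fn1 n (VS n))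
    (a : Col n) (V : VS n) :
    rOp n w c Φ a V = ∑ l, w (V c) a l * Φ l (V + sg n c a l) := rfl

lemma sg_same (n : ℕ) (c : ℕ) (a l : Col n) (V : VS n) :
    (V + sg n c a l) c = V c + (eZ n a - eZ n l) := by simp [sg]
lemma sg_diff (n : ℕ) (c c' : ℕ) (h : c ≠ c') (a l : Col n) (V : VS n) :
    (V + sg n c a l) c' = V c' := by simp [sg, h.symm]
lemma sg_perm (n : ℕ) (c : ℕ) (a b l m : Col n) (V : VS n) :
    V + sg n c a l + sg n c b m = V + sg n c b l + sg n c a m := by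
  simp only [sg, add_assoc, ← Pi.single_add]; congr 2; abel
lemma sg_perm' (n : ℕ) (c : ℕ) (a b l m : Col n) (V : VS n) :
    V + sg n c a m + sg n c b l = V + sg n c a l + sg n c b m := by
  simp only [sg, add_assoc, ← Pi.single_add]; congr 2; abel

lemma exch_rel (n : ℕ) (c : ℕ) (w1 w2 w1' w2' : (Col n → ℤ) → Col n → Col n → ℂ)
    (u v u' v' : ℕ → ℕ → ℂ)
    (hw : ∀ (I : Col n → ℤ) (a b l m : Col n),
      u a b * (w1 I a l * w2 (I + (eZ n a - eZ n l)) b m)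
       + v a b * (w1 I b l * w2 (I + (eZ n b - eZ n l)) a m)
      = (w1' I a l * w2' (I + (eZ n a - eZ n l)) b m) * u' l m
       + (w1' I a m * w2' (I + (eZ n a - eZ n m)) b l) * v' m l) :
    opSS n (VS n) u v * lift1 n (VS n) (rOp n w1 c) * lift2 n (VS n) (rOp n w2 c)
     = lift1 n (VS n) (rOp n w1' c) * lift2 n (VS n) (rOp n w2' c) * opSS n (VS n) u' v' := by
  refine LinearMap.ext fun Φ => ?_
  funext a b V
  simp only [Module.End.mul_apply, opSS_apply, lift1_apply, lift2_apply, rOp_apply, sg_same]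
  have e2 : ∑ l, w1' (V c) a l * ∑ m, w2' (V c + (eZ n a - eZ n l)) b m *
        (u' l m * Φ l m (V + sg n c a l + sg n c b m) + v' l m * Φ m l (V + sg n c a l + sg n c b m))
      = ∑ l, ∑ m, ((w1' (V c) a l * w2' (V c + (eZ n a - eZ n l)) b m) * u' l m
       + (w1' (V c) a m * w2' (V c + (eZ n a - eZ n m)) b l) * v' m l)
        * Φ l m (V + sg n c a l + sg n c b m) := by
    simp only [Finset.mul_sum, mul_add, add_mul, Finset.sum_add_distrib]
    congr 1
    · exact Finset.sum_congr rfl fun l _ => Finset.sum_congr rfl fun m _ => by ring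
    · rw [Finset.sum_comm]
      refine Finset.sum_congr rfl fun l _ => Finset.sum_congr rfl fun m _ => ?_
      rw [sg_perm' n c a b l m]; ring
  rw [e2]
  simp only [← hw, Finset.mul_sum, add_mul, Finset.sum_add_distrib]
  congr 1
  · exact Finset.sum_congr rfl fun l _ => Finset.sum_congr rfl fun m _ => by ring
  · refine Finset.sum_congr rfl fun l _ => Finset.sum_congr rfl fun m _ => ?_
    rw [sg_perm n c a b l m]; ring

lemma comm_rel (n : ℕ) (c c' : ℕ) (h : c ≠ c') (w1 w2 : (Col n → ℤ) → Col n → Col n → ℂ) :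
    lift1 n (VS n) (rOp n w1 c) * lift2 n (VS n) (rOp n w2 c')
     = lift2 n (VS n) (rOp n w2 c') * lift1 n (VS n) (rOp n w1 c) := by
  refine LinearMap.ext fun Φ => ?_
  funext a b V
  simp only [Module.End.mul_apply, lift1_apply, lift2_apply, rOp_apply, sg_diff n c c' h,
    sg_diff n c' c h.symm, Finset.mul_sum]
  rw [Finset.sum_comm]
  refine Finset.sum_congr rfl fun l _ => Finset.sum_congr rfl fun m _ => ?_
  rw [add_right_comm]; ring

lemma dg_rel (n : ℕ) (c : ℕ) (w1 w2 : (Col n → ℤ) → Col n → Col n → ℂ)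
    (u v : ℕ → ℕ → ℂ)
    (hw : ∀ (I : Col n → ℤ) (a b e l : Col n),
      w1 I a e * u e b * w2 (I + (eZ n a - eZ n e)) b l
        + (if e = b then ∑ k, w1 I a k * w2 (I + (eZ n a - eZ n k)) k l * v k b else 0)
      = w2 I b l * u a l * w1 (I + (eZ n b - eZ n l)) a e
        + (if l = a then ∑ k, w2 I b k * w1 (I + (eZ n b - eZ n k)) k e * v a k else 0)) :
    lift1 n (VS n) (rOp n w1 c) * opSS n (VS n) u v * lift2 n (VS n) (rOp n w2 c)
     = lift2 n (VS n) (rOp n w2 c) * opSS n (VS n) u v * lift1 n (VS n) (rOp n w1 c) := by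
  refine LinearMap.ext fun Φ => ?_
  funext a b V
  simp only [Module.End.mul_apply, opSS_apply, lift1_apply, lift2_apply, rOp_apply, sg_same]
  have tel : ∀ x y z : Col n, V + sg n c x y + sg n c y z = V + sg n c x z := by
    intro x y z
    simp only [sg, add_assoc, ← Pi.single_add]; congr 2; abel
  have e1 : ∑ e, ∑ l, (w1 (V c) a e * u e b * w2 (V c + (eZ n a - eZ n e)) b l
        + (if e = b then ∑ k, w1 (V c) a k * w2 (V c + (eZ n a - eZ n k)) k l * v k b else 0))
        * Φ e l (V + sg n c a e + sg n c b l) =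
      ∑ x, w1 (V c) a x * (u x b * ∑ l, w2 (V c + (eZ n a - eZ n x)) b l
            * Φ x l (V + sg n c a x + sg n c b l)
          + v x b * ∑ l, w2 (V c + (eZ n a - eZ n x)) x l
            * Φ b l (V + sg n c a x + sg n c x l)) := by
    simp only [mul_add, add_mul, Finset.sum_add_distrib]
    congr 1
    · simp only [Finset.mul_sum]
      exact Finset.sum_congr rfl fun l _ => Finset.sum_congr rfl fun m _ => by ring
    · rw [Finset.sum_eq_single b]
      · simp only [if_true, tel, Finset.sum_mul, Finset.mul_sum]
        rw [Finset.sum_comm]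
        exact Finset.sum_congr rfl fun l _ => Finset.sum_congr rfl fun m _ => by ring
      · intro e _ he; simp [he]
      · simp
  have e2 : ∑ e, ∑ l, (w2 (V c) b l * u a l * w1 (V c + (eZ n b - eZ n l)) a e
        + (if l = a then ∑ k, w2 (V c) b k * w1 (V c + (eZ n b - eZ n k)) k e * v a k else 0))
        * Φ e l (V + sg n c a e + sg n c b l) =
      ∑ x, w2 (V c) b x * (u a x * ∑ e, w1 (V c + (eZ n b - eZ n x)) a e
            * Φ e x (V + sg n c b x + sg n c a e)
          + v a x * ∑ e, w1 (V c + (eZ n b - eZ n x)) x e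
            * Φ e a (V + sg n c b x + sg n c x e)) := by
    simp only [mul_add, add_mul, Finset.sum_add_distrib]
    congr 1
    · simp only [Finset.mul_sum]
      rw [Finset.sum_comm]
      refine Finset.sum_congr rfl fun l _ => Finset.sum_congr rfl fun m _ => ?_
      rw [add_right_comm]; ring
    · rw [Finset.sum_comm, Finset.sum_eq_single a]
      · simp only [if_true, tel, Finset.sum_mul, Finset.mul_sum]
        rw [Finset.sum_comm]
        refine Finset.sum_congr rfl fun l _ => Finset.sum_congr rfl fun m _ => ?_
        rw [add_right_comm, tel]; ring
      · intro e _ he; simp [he]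
      · simp
  rw [← e1, ← e2]
  simp only [hw]


lemma rStay_div (q s x y : ℂ) (a b : ℕ) : rStay q (x/s) (y/s) a b = rStay q x y a b * s⁻¹ := by
  unfold rStay; split_ifs <;> ring
lemma rSwap_div (q s x y : ℂ) (a b : ℕ) : rSwap q (x/s) (y/s) a b = rSwap q x y a b * s⁻¹ := by
  unfold rSwap; split_ifs <;> ring

noncomputable def gOp (n : ℕ) (q s x : ℂ) (c : ℕ) := rOp n (gw n q s x) c
noncomputable def dOp (n : ℕ) (q s x : ℂ) (c : ℕ) := rOp n (dw n q s x) c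

noncomputable def opR (n : ℕ) (q x y : ℂ) : Module.End ℂ (Fn2 n (VS n)) :=
  opSS n (VS n) (rStay q x y) (rSwap q x y)
noncomputable def opR' (n : ℕ) (q x y : ℂ) : Module.End ℂ (Fn2 n (VS n)) :=
  opSS n (VS n) (fun a b => rStay q x y b a) (fun a b => rSwap q x y b a)
noncomputable def opS (n : ℕ) (q z : ℂ) : Module.End ℂ (Fn2 n (VS n)) :=
  opSS n (VS n) (sStay q z) (sSwap q z)
noncomputable def opS' (n : ℕ) (q z : ℂ) : Module.End ℂ (Fn2 n (VS n)) :=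
  (1 - q*z) • opT n (VS n) q + ((q-1)*(q*z)) • 1

lemma GG_rel (n : ℕ) (q s x y : ℂ) (hq : q ≠ 0) (hs : s ≠ 0) (c : ℕ) :
    opR n q x y * lift1 n (VS n) (gOp n q s y c) * lift2 n (VS n) (gOp n q s x c)
     = lift1 n (VS n) (gOp n q s x c) * lift2 n (VS n) (gOp n q s y c) * opR n q x y := by
  refine exch_rel n c _ _ _ _ _ _ _ _ fun I a b l m => ?_
  have := gg_id q (x/s) (y/s) hq (HH n q (s^2) I) a b l m
  simp only [rStay_div, rSwap_div] at this
  simp only [gw, HH_shift n q _ hq]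
  have hh := congrArg (fun z => s * (1 - s*x)⁻¹ * (1 - s*y)⁻¹ * z) this
  simp only [mul_add] at hh
  have hss : s * s⁻¹ = 1 := mul_inv_cancel₀ hs
  linear_combination (norm := skip) hh
  simp only [div_eq_mul_inv (wG _ _ _ _)]
  generalize wG _ _ _ _ = A1
  generalize wG _ _ _ _ = A2
  generalize wG _ _ _ _ = A3
  generalize wG _ _ _ _ = A4
  generalize wG _ _ _ _ = A5
  generalize wG _ _ _ _ = A6
  generalize wG _ _ _ _ = A7
  generalize wG _ _ _ _ = A8
  field_simp
  ring

lemma DD_rel (n : ℕ) (q s x y : ℂ) (hq : q ≠ 0) (hs : s ≠ 0) (c : ℕ) :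
    opR' n q x y * lift1 n (VS n) (dOp n q s y c) * lift2 n (VS n) (dOp n q s x c)
     = lift1 n (VS n) (dOp n q s x c) * lift2 n (VS n) (dOp n q s y c) * opR' n q x y := by
  refine exch_rel n c _ _ _ _ _ _ _ _ fun I a b l m => ?_
  have := dd_id q (s^2) (x/s) (y/s) hq (HH n q (s^2) I) a b l m
  simp only [rStay_div, rSwap_div] at this
  simp only [dw, HH_shift n q _ hq]
  have hh := congrArg (fun z => s * (1 - s*x)⁻¹ * (1 - s*y)⁻¹ * z) this
  simp only [mul_add] at hh
  linear_combination (norm := skip) hh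
  simp only [div_eq_mul_inv (wD _ _ _ _ _)]
  generalize wD _ _ _ _ _ = A1
  generalize wD _ _ _ _ _ = A2
  generalize wD _ _ _ _ _ = A3
  generalize wD _ _ _ _ _ = A4
  generalize wD _ _ _ _ _ = A5
  generalize wD _ _ _ _ _ = A6
  generalize wD _ _ _ _ _ = A7
  generalize wD _ _ _ _ _ = A8
  field_simp
  ring

lemma DG_rel (n : ℕ) (q s x y : ℂ) (hq : q ≠ 0) (hs : s ≠ 0) (c : ℕ) :
    lift1 n (VS n) (dOp n q s y c) * opS n q (x*y) * lift2 n (VS n) (gOp n q s x c)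
     = lift2 n (VS n) (gOp n q s x c) * opS n q (x*y) * lift1 n (VS n) (dOp n q s y c) := by
  refine dg_rel n c _ _ _ _ fun I a b e l => ?_
  have hz : s^2 * (x/s) * (y/s) = x * y := by field_simp
  have := dg_id q (s^2) (x/s) (y/s) hq (HH n q (s^2) I)
    (HH_ne n q _ hq (pow_ne_zero 2 hs) I) (2*n+1) (HH_zero n q _ I) (HH_last n q _ I)
    a b e l a.isLt b.isLt e.isLt l.isLt
  simp only [hz, Finset.sum_range, ← Fin.ext_iff] at this
  simp only [gw, dw, HH_shift n q _ hq]
  have hh := congrArg (fun z => (1 - s*x)⁻¹ * (1 - s*y)⁻¹ * z) this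
  simp only [mul_add, mul_ite, mul_zero, Finset.mul_sum] at hh
  have c1 : ∀ p q' r D D' : ℂ, p / D * q' * (r / D') = D'⁻¹ * D⁻¹ * (p * q' * r) := by
    intros; simp only [div_eq_mul_inv]; ring
  have c2 : ∀ p q' r D D' : ℂ, p / D * (q' / D') * r = D'⁻¹ * D⁻¹ * (p * q' * r) := by
    intros; simp only [div_eq_mul_inv]; ring
  have c3 : ∀ p q' r D D' : ℂ, p / D * q' * (r / D') = D⁻¹ * D'⁻¹ * (p * q' * r) := by
    intros; simp only [div_eq_mul_inv]; ring
  have c4 : ∀ p q' r D D' : ℂ, p / D * (q' / D') * r = D⁻¹ * D'⁻¹ * (p * q' * r) := by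
    intros; simp only [div_eq_mul_inv]; ring
  rw [c1, c3 (wG _ _ _ _)]
  simp only [c2 (wD _ _ _ _ _), c4 (wG _ _ _ _)]
  exact hh

lemma opR'_eq (n : ℕ) (q x y : ℂ) :
    opR' n q x y = (x-y) • opT n (VS n) q + ((q-1)*y) • 1 := by
  refine LinearMap.ext fun Φ => ?_
  funext a b V
  simp only [opR', opT, opSS_apply, LinearMap.add_apply, LinearMap.smul_apply,
    Module.End.one_apply, Pi.add_apply, Pi.smul_apply, smul_eq_mul, rStay, rSwap]
  rcases lt_trichotomy (a:ℕ) b with h | h | h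
  · simp only [h, not_lt_of_gt h, if_true, if_false]; ring
  · have : a = b := Fin.ext h
    subst this; simp only [lt_irrefl, if_false]; ring
  · simp only [h, not_lt_of_gt h, if_true, if_false]; ring

lemma opS_eq (n : ℕ) (q z : ℂ) : opS n q z = opP n (VS n) * opS' n q z := by
  refine LinearMap.ext fun Φ => ?_
  funext a b V
  simp only [opS, opS', opT, opSS_apply, Module.End.mul_apply, opP_apply, LinearMap.add_apply,
    LinearMap.smul_apply, Module.End.one_apply, Pi.add_apply, Pi.smul_apply, smul_eq_mul,
    sStay, sSwap]
  rcases lt_trichotomy (a:ℕ) b with h | h | h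
  · simp only [h, not_lt_of_gt h, if_true, if_false]; ring
  · have : a = b := Fin.ext h
    subst this; simp only [lt_irrefl, if_false]; ring
  · simp only [h, not_lt_of_gt h, if_true, if_false]; ring

lemma opR_P (n : ℕ) (q x y : ℂ) :
    opR n q x y * opP n (VS n) = opP n (VS n) * opR' n q x y := rfl

/-- the cap operator -/
noncomputable def capOp (n : ℕ) (ν t qh x : ℂ) : Module.End ℂ (Fn1 n (VS n)) :=
  1 + phiF ν t (qh * x⁻¹) • opE n (VS n) t

lemma lift2_cap (n : ℕ) (ν t qh x : ℂ) :
    lift2 n (VS n) (capOp n ν t qh x)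
      = 1 + phiF ν t (qh * x⁻¹) • lift2 n (VS n) (opE n (VS n) t) := rfl

/-- reflection equation -/
lemma refl_rel (n : ℕ) (q t ν qh x y : ℂ) (hq : q ≠ 0) (hν : ν ≠ 0) (hqh : qh ^ 2 * q = 1)
    (hx : x ≠ 0) (hy : y ≠ 0)
    (hx1 : 1 - ν * t * (qh * x⁻¹) ≠ 0) (hx2 : 1 + ν⁻¹ * (qh * x⁻¹) ≠ 0)
    (hy1 : 1 - ν * t * (qh * y⁻¹) ≠ 0) (hy2 : 1 + ν⁻¹ * (qh * y⁻¹) ≠ 0) :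
    opR n q x y * (lift1 n (VS n) (capOp n ν t qh y) * opS n q (x*y)
        * lift2 n (VS n) (capOp n ν t qh x))
     = (lift1 n (VS n) (capOp n ν t qh x) * opS n q (x*y)
        * lift2 n (VS n) (capOp n ν t qh y)) * opR' n q x y := by
  have key := refl_abs (opT n (VS n) q) (lift2 n (VS n) (opE n (VS n) t)) q t (x-y) ((q-1)*y)
    (1 - q*(x*y)) ((q-1)*(q*(x*y))) (phiF ν t (qh * x⁻¹)) (phiF ν t (qh * y⁻¹))
    (opT_sq n (VS n) q) (by rw [← lift2_mul, opE_sq]; rfl) (opTE n (VS n) q t)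
    (by
      have := refl_scalar q t ν qh x y hq hν hqh hx hy hx1 hx2 hy1 hy2
      linear_combination this)
  rw [← lift2_cap, ← lift2_cap, ← opR'_eq] at key
  change opR' n q x y * lift2 n (VS n) (capOp n ν t qh y) * opS' n q (x*y)
    * lift2 n (VS n) (capOp n ν t qh x) = lift2 n (VS n) (capOp n ν t qh x) * opS' n q (x*y)
    * lift2 n (VS n) (capOp n ν t qh y) * opR' n q x y at key
  rw [opS_eq]
  calc opR n q x y * (lift1 n (VS n) (capOp n ν t qh y) * (opP n (VS n) * opS' n q (x*y))
        * lift2 n (VS n) (capOp n ν t qh x))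
      = opP n (VS n) * (opR' n q x y * lift2 n (VS n) (capOp n ν t qh y) * opS' n q (x*y)
          * lift2 n (VS n) (capOp n ν t qh x)) := rfl
    _ = opP n (VS n) * (lift2 n (VS n) (capOp n ν t qh x) * opS' n q (x*y)
          * lift2 n (VS n) (capOp n ν t qh y) * opR' n q x y) := by rw [key]
    _ = _ := rfl

lemma cap1_comm (n : ℕ) (ν t qh x : ℂ) (w : (Col n → ℤ) → Col n → Col n → ℂ) (c : ℕ) :
    lift1 n (VS n) (capOp n ν t qh x) * lift2 n (VS n) (rOp n w c)
      = lift2 n (VS n) (rOp n w c) * lift1 n (VS n) (capOp n ν t qh x) := by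
  refine LinearMap.ext fun Φ => ?_
  funext a b V
  simp only [Module.End.mul_apply, lift1_apply, lift2_apply, rOp_apply, capOp, LinearMap.add_apply,
    LinearMap.smul_apply, Module.End.one_apply, Pi.add_apply, Pi.smul_apply, smul_eq_mul,
    opE_apply, mul_add, mul_sub, Finset.mul_sum, Finset.sum_add_distrib, Finset.sum_sub_distrib]
  congr 2 <;> exact Finset.sum_congr rfl fun l _ => by ring

lemma cap2_comm (n : ℕ) (ν t qh x : ℂ) (w : (Col n → ℤ) → Col n → Col n → ℂ) (c : ℕ) :
    lift2 n (VS n) (capOp n ν t qh x) * lift1 n (VS n) (rOp n w c)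
      = lift1 n (VS n) (rOp n w c) * lift2 n (VS n) (capOp n ν t qh x) := by
  have := cap1_comm n ν t qh x w c
  have h2 := congrArg (fun A => opP n (VS n) * A * opP n (VS n)) this
  exact h2


/-- Γ row operator on the columns `< m` -/
noncomputable def gRow (n : ℕ) (q s x : ℂ) : ℕ → Module.End ℂ (Fn1 n (VS n))
  | 0 => 1
  | m+1 => gOp n q s x m * gRow n q s x m

/-- Δ row operator on the columns `< m` -/
noncomputable def dRow (n : ℕ) (q s x : ℂ) : ℕ → Module.End ℂ (Fn1 n (VS n))
  | 0 => 1
  | m+1 => dRow n q s x m * dOp n q s x m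

lemma lift1_one (n : ℕ) (Ω : Type) : lift1 n Ω 1 = 1 := rfl
lemma lift2_one (n : ℕ) (Ω : Type) : lift2 n Ω 1 = 1 := rfl

lemma gRow1_comm (n : ℕ) (q s x : ℂ) (w : (Col n → ℤ) → Col n → Col n → ℂ) (m c : ℕ) (h : m ≤ c) :
    Commute (lift1 n (VS n) (gRow n q s x m)) (lift2 n (VS n) (rOp n w c)) := by
  induction m with
  | zero => exact Commute.one_left _
  | succ m ih =>
    rw [gRow, lift1_mul]
    exact Commute.mul_left (comm_rel n m c (by omega) _ _) (ih (by omega))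

lemma dRow1_comm (n : ℕ) (q s x : ℂ) (w : (Col n → ℤ) → Col n → Col n → ℂ) (m c : ℕ) (h : m ≤ c) :
    Commute (lift1 n (VS n) (dRow n q s x m)) (lift2 n (VS n) (rOp n w c)) := by
  induction m with
  | zero => exact Commute.one_left _
  | succ m ih =>
    rw [dRow, lift1_mul]
    exact Commute.mul_left (ih (by omega)) (comm_rel n m c (by omega) _ _)

lemma gRow2_comm (n : ℕ) (q s x : ℂ) (w : (Col n → ℤ) → Col n → Col n → ℂ) (m c : ℕ) (h : m ≤ c) :
    Commute (lift1 n (VS n) (rOp n w c)) (lift2 n (VS n) (gRow n q s x m)) := by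
  induction m with
  | zero => exact Commute.one_right _
  | succ m ih =>
    rw [gRow, lift2_mul]
    exact Commute.mul_right (comm_rel n c m (by omega) _ _) (ih (by omega))

lemma dRow2_comm (n : ℕ) (q s x : ℂ) (w : (Col n → ℤ) → Col n → Col n → ℂ) (m c : ℕ) (h : m ≤ c) :
    Commute (lift1 n (VS n) (rOp n w c)) (lift2 n (VS n) (dRow n q s x m)) := by
  induction m with
  | zero => exact Commute.one_right _
  | succ m ih =>
    rw [dRow, lift2_mul]
    exact Commute.mul_right (ih (by omega)) (comm_rel n c m (by omega) _ _)

lemma GGrow (n : ℕ) (q s x y : ℂ) (hq : q ≠ 0) (hs : s ≠ 0) (m : ℕ) :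
    opR n q x y * (lift1 n (VS n) (gRow n q s y m) * lift2 n (VS n) (gRow n q s x m))
     = lift1 n (VS n) (gRow n q s x m) * lift2 n (VS n) (gRow n q s y m) * opR n q x y := by
  induction m with
  | zero => rfl
  | succ m ih =>
    simp only [gRow, lift1_mul, lift2_mul]
    have c1 := (gRow1_comm n q s y (gw n q s x) m m le_rfl).eq
    have c2 := (gRow1_comm n q s x (gw n q s y) m m le_rfl).eq
    have g := GG_rel n q s x y hq hs m
    unfold gOp at *
    generalize lift1 n (VS n) (rOp n (gw n q s y) m) = g1 at *
    generalize lift2 n (VS n) (rOp n (gw n q s y) m) = g2 at *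
    generalize lift1 n (VS n) (rOp n (gw n q s x) m) = k1 at *
    generalize lift2 n (VS n) (rOp n (gw n q s x) m) = k2 at *
    generalize lift1 n (VS n) (gRow n q s y m) = G1 at *
    generalize lift2 n (VS n) (gRow n q s y m) = G2 at *
    generalize lift1 n (VS n) (gRow n q s x m) = K1 at *
    generalize lift2 n (VS n) (gRow n q s x m) = K2 at *
    generalize opR n q x y = R at *
    calc R * (g1 * G1 * (k2 * K2)) = R * g1 * (G1 * k2) * K2 := by simp only [mul_assoc]
      _ = (R * g1 * k2) * (G1 * K2) := by rw [c1]; simp only [mul_assoc]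
      _ = k1 * g2 * (R * (G1 * K2)) := by rw [g]; simp only [mul_assoc]
      _ = k1 * (g2 * K1) * G2 * R := by rw [ih]; simp only [mul_assoc]
      _ = _ := by rw [← c2]; simp only [mul_assoc]

lemma DDrow (n : ℕ) (q s x y : ℂ) (hq : q ≠ 0) (hs : s ≠ 0) (m : ℕ) :
    opR' n q x y * (lift1 n (VS n) (dRow n q s y m) * lift2 n (VS n) (dRow n q s x m))
     = lift1 n (VS n) (dRow n q s x m) * lift2 n (VS n) (dRow n q s y m) * opR' n q x y := by
  induction m with
  | zero => rfl
  | succ m ih =>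
    simp only [dRow, lift1_mul, lift2_mul]
    have c1 := (dRow2_comm n q s x (dw n q s y) m m le_rfl).eq
    have c2 := (dRow2_comm n q s y (dw n q s x) m m le_rfl).eq
    have g := DD_rel n q s x y hq hs m
    unfold dOp at *
    generalize lift1 n (VS n) (rOp n (dw n q s y) m) = g1 at *
    generalize lift2 n (VS n) (rOp n (dw n q s y) m) = g2 at *
    generalize lift1 n (VS n) (rOp n (dw n q s x) m) = k1 at *
    generalize lift2 n (VS n) (rOp n (dw n q s x) m) = k2 at *
    generalize lift1 n (VS n) (dRow n q s y m) = G1 at *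
    generalize lift2 n (VS n) (dRow n q s y m) = G2 at *
    generalize lift1 n (VS n) (dRow n q s x m) = K1 at *
    generalize lift2 n (VS n) (dRow n q s x m) = K2 at *
    generalize opR' n q x y = R at *
    calc R * (G1 * g1 * (K2 * k2)) = R * G1 * (g1 * K2) * k2 := by simp only [mul_assoc]
      _ = (R * (G1 * K2)) * g1 * k2 := by rw [c1]; simp only [mul_assoc]
      _ = K1 * G2 * (R * g1 * k2) := by rw [ih]; simp only [mul_assoc]
      _ = K1 * (G2 * k1) * g2 * R := by rw [g]; simp only [mul_assoc]
      _ = _ := by rw [← c2]; simp only [mul_assoc]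

lemma DGrow (n : ℕ) (q s x y : ℂ) (hq : q ≠ 0) (hs : s ≠ 0) (m : ℕ) :
    lift1 n (VS n) (dRow n q s y m) * opS n q (x*y) * lift2 n (VS n) (gRow n q s x m)
     = lift2 n (VS n) (gRow n q s x m) * opS n q (x*y) * lift1 n (VS n) (dRow n q s y m) := by
  induction m with
  | zero => rfl
  | succ m ih =>
    simp only [dRow, gRow, lift1_mul, lift2_mul]
    have c1 := (dRow1_comm n q s y (gw n q s x) m m le_rfl).eq
    have c2 := (gRow2_comm n q s x (dw n q s y) m m le_rfl).eq
    have g := DG_rel n q s x y hq hs m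
    unfold dOp gOp at *
    generalize lift1 n (VS n) (rOp n (dw n q s y) m) = d at *
    generalize lift2 n (VS n) (rOp n (gw n q s x) m) = k at *
    generalize lift1 n (VS n) (dRow n q s y m) = D at *
    generalize lift2 n (VS n) (gRow n q s x m) = K at *
    generalize opS n q (x*y) = S at *
    calc D * d * S * (k * K) = D * (d * S * k) * K := by simp only [mul_assoc]
      _ = (D * k) * S * (d * K) := by rw [g]; simp only [mul_assoc]
      _ = k * (D * S * K) * d := by rw [c1, c2]; simp only [mul_assoc]
      _ = _ := by rw [ih]; simp only [mul_assoc]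

lemma cap1_comm_gRow (n : ℕ) (q s x ν t qh y : ℂ) (m : ℕ) :
    Commute (lift1 n (VS n) (capOp n ν t qh y)) (lift2 n (VS n) (gRow n q s x m)) := by
  induction m with
  | zero => exact Commute.one_right _
  | succ m ih =>
    rw [gRow, lift2_mul]
    exact Commute.mul_right (cap1_comm n ν t qh y _ m) ih

lemma cap2_comm_dRow (n : ℕ) (q s x ν t qh y : ℂ) (m : ℕ) :
    Commute (lift2 n (VS n) (capOp n ν t qh y)) (lift1 n (VS n) (dRow n q s x m)) := by
  induction m with
  | zero => exact Commute.one_right _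
  | succ m ih =>
    rw [dRow, lift1_mul]
    exact Commute.mul_right ih (cap2_comm n ν t qh y _ m)

/-- operator of a pair of rows -/
noncomputable def wOp (n L : ℕ) (q s ν t qh x : ℂ) : Module.End ℂ (Fn1 n (VS n)) :=
  gRow n q s x L * capOp n ν t qh x * dRow n q s x L

lemma two_rel (n L : ℕ) (q s t ν qh x y : ℂ) (hq : q ≠ 0) (hs : s ≠ 0)
    (hν : ν ≠ 0) (hqh : qh ^ 2 * q = 1)
    (hx : x ≠ 0) (hy : y ≠ 0)
    (hx1 : 1 - ν * t * (qh * x⁻¹) ≠ 0) (hx2 : 1 + ν⁻¹ * (qh * x⁻¹) ≠ 0)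
    (hy1 : 1 - ν * t * (qh * y⁻¹) ≠ 0) (hy2 : 1 + ν⁻¹ * (qh * y⁻¹) ≠ 0) :
    opR n q x y * (lift1 n (VS n) (wOp n L q s ν t qh y) * opS n q (x*y)
        * lift2 n (VS n) (wOp n L q s ν t qh x))
     = (lift1 n (VS n) (wOp n L q s ν t qh x) * opS n q (x*y)
        * lift2 n (VS n) (wOp n L q s ν t qh y)) * opR' n q x y := by
  have r := refl_rel n q t ν qh x y hq hν hqh hx hy hx1 hx2 hy1 hy2
  have gg := GGrow n q s x y hq hs L
  have dd := DDrow n q s x y hq hs L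
  have dg1 := DGrow n q s x y hq hs L
  have dg2 := DGrow n q s y x hq hs L
  rw [mul_comm y x] at dg2
  have a1 := (cap1_comm_gRow n q s x ν t qh y L).eq
  have a2 := (cap1_comm_gRow n q s y ν t qh x L).eq
  have b1 := (cap2_comm_dRow n q s x ν t qh y L).eq
  have b2 := (cap2_comm_dRow n q s y ν t qh x L).eq
  simp only [wOp, lift1_mul, lift2_mul]
  generalize lift1 n (VS n) (gRow n q s x L) = Gx1 at *
  generalize lift2 n (VS n) (gRow n q s x L) = Gx2 at *
  generalize lift1 n (VS n) (gRow n q s y L) = Gy1 at *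
  generalize lift2 n (VS n) (gRow n q s y L) = Gy2 at *
  generalize lift1 n (VS n) (dRow n q s x L) = Dx1 at *
  generalize lift2 n (VS n) (dRow n q s x L) = Dx2 at *
  generalize lift1 n (VS n) (dRow n q s y L) = Dy1 at *
  generalize lift2 n (VS n) (dRow n q s y L) = Dy2 at *
  generalize lift1 n (VS n) (capOp n ν t qh x) = Cx1 at *
  generalize lift2 n (VS n) (capOp n ν t qh x) = Cx2 at *
  generalize lift1 n (VS n) (capOp n ν t qh y) = Cy1 at *
  generalize lift2 n (VS n) (capOp n ν t qh y) = Cy2 at *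
  generalize opS n q (x*y) = S at *
  generalize opR n q x y = R at *
  generalize opR' n q x y = R' at *
  have e1 : Gy1 * Cy1 * Dy1 * S * (Gx2 * Cx2 * Dx2)
      = (Gy1 * Gx2) * (Cy1 * S * Cx2) * (Dy1 * Dx2) := by
    calc Gy1 * Cy1 * Dy1 * S * (Gx2 * Cx2 * Dx2)
        = Gy1 * Cy1 * (Dy1 * S * Gx2) * Cx2 * Dx2 := by simp only [mul_assoc]
      _ = Gy1 * (Cy1 * Gx2) * S * (Dy1 * Cx2) * Dx2 := by rw [dg1]; simp only [mul_assoc]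
      _ = _ := by rw [a1, ← b2]; simp only [mul_assoc]
  have e2 : Gx1 * Cx1 * Dx1 * S * (Gy2 * Cy2 * Dy2)
      = (Gx1 * Gy2) * (Cx1 * S * Cy2) * (Dx1 * Dy2) := by
    calc Gx1 * Cx1 * Dx1 * S * (Gy2 * Cy2 * Dy2)
        = Gx1 * Cx1 * (Dx1 * S * Gy2) * Cy2 * Dy2 := by simp only [mul_assoc]
      _ = Gx1 * (Cx1 * Gy2) * S * (Dx1 * Cy2) * Dy2 := by rw [dg2]; simp only [mul_assoc]
      _ = _ := by rw [a2, ← b1]; simp only [mul_assoc]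
  rw [e1, e2]
  calc R * ((Gy1 * Gx2) * (Cy1 * S * Cx2) * (Dy1 * Dx2))
      = (R * (Gy1 * Gx2)) * (Cy1 * S * Cx2) * (Dy1 * Dx2) := by simp only [mul_assoc]
    _ = (Gx1 * Gy2) * (R * (Cy1 * S * Cx2)) * (Dy1 * Dx2) := by rw [gg]; simp only [mul_assoc]
    _ = (Gx1 * Gy2) * (Cx1 * S * Cy2) * (R' * (Dy1 * Dx2)) := by rw [r]; simp only [mul_assoc]
    _ = _ := by rw [dd]; simp only [mul_assoc]

/-- transfer operator of a pair of rows with incoming color `a` -/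
noncomputable def uOp (n L : ℕ) (q s ν t qh : ℂ) (a : Col n) (x : ℂ) (F : VS n → ℂ) : VS n → ℂ :=
  fun V => wOp n L q s ν t qh x (fun c V => if c = mid n then F V else 0) a V

/-- the two-particle vacuum -/
def vac (n : ℕ) (F : VS n → ℂ) : Fn2 n (VS n) :=
  fun a b V => if a = mid n then (if b = mid n then F V else 0) else 0

lemma lift2_vac (n : ℕ) (F : VS n → ℂ) (A : Module.End ℂ (Fn1 n (VS n))) (a b : Col n) (V : VS n) :
    lift2 n (VS n) A (vac n F) a b V
      = if a = mid n then A (fun c V => if c = mid n then F V else 0) b V else 0 := by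
  rw [lift2_apply]
  by_cases h : a = mid n
  · subst h
    have : vac n F (mid n) = fun c V => if c = mid n then F V else 0 := by
      funext b V; simp [vac]
    rw [this, if_pos rfl]
  · simp only [h, if_false]
    have : vac n F a = 0 := by funext b V; simp [vac, h]
    rw [this, map_zero]; rfl

lemma two_apply (n L : ℕ) (q s ν t qh x y : ℂ) (a b : Col n) (hb : b ≠ mid n) (F : VS n → ℂ) (V : VS n) :
    (lift1 n (VS n) (wOp n L q s ν t qh y) * opS n q (x*y)
        * lift2 n (VS n) (wOp n L q s ν t qh x)) (vac n F) a b V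
     = sStay q (x*y) (mid n) b *
        uOp n L q s ν t qh a y (uOp n L q s ν t qh b x F) V := by
  simp only [Module.End.mul_apply, lift1_apply, opS, uOp]
  have : (fun a' => (opSS n (VS n) (sStay q (x*y)) (sSwap q (x*y)))
        (lift2 n (VS n) (wOp n L q s ν t qh x) (vac n F)) a' b)
      = sStay q (x*y) (mid n) b • (fun (c : Col n) (V : VS n) => if c = mid n then
          wOp n L q s ν t qh x (fun c V => if c = mid n then F V else 0) b V else 0) := by
    funext a' V
    simp only [opSS_apply, lift2_vac, hb, if_false, mul_zero, add_zero, Pi.smul_apply, smul_eq_mul]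
    by_cases h : a' = mid n
    · simp [h]
    · simp [h]
  rw [this, map_smul]; rfl

lemma exchange (n L : ℕ) (q s t ν qh x y : ℂ) (hq : q ≠ 0) (hs : s ≠ 0)
    (hν : ν ≠ 0) (hqh : qh ^ 2 * q = 1)
    (hx : x ≠ 0) (hy : y ≠ 0)
    (hx1 : 1 - ν * t * (qh * x⁻¹) ≠ 0) (hx2 : 1 + ν⁻¹ * (qh * x⁻¹) ≠ 0)
    (hy1 : 1 - ν * t * (qh * y⁻¹) ≠ 0) (hy2 : 1 + ν⁻¹ * (qh * y⁻¹) ≠ 0)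
    (a b : Col n) (ha : a ≠ mid n) (hb : b ≠ mid n) (hab : a < b) (F : VS n → ℂ) (V : VS n) :
    (q-1)*y * (sStay q (x*y) (mid n) a *
        uOp n L q s ν t qh b y (uOp n L q s ν t qh a x F) V)
     + q*(x-y) * (sStay q (x*y) (mid n) b *
        uOp n L q s ν t qh a y (uOp n L q s ν t qh b x F) V)
     = (q*x-y) * (sStay q (x*y) (mid n) a *
        uOp n L q s ν t qh b x (uOp n L q s ν t qh a y F) V) := by
  have key := congrFun (congrFun (congrFun (congrArg (fun A => A (vac n F))
    (two_rel n L q s t ν qh x y hq hs hν hqh hx hy hx1 hx2 hy1 hy2)) b) a) V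
  generalize hK1 : lift1 n (VS n) (wOp n L q s ν t qh y) * opS n q (x*y)
    * lift2 n (VS n) (wOp n L q s ν t qh x) = K1 at key
  generalize hK2 : lift1 n (VS n) (wOp n L q s ν t qh x) * opS n q (x*y)
    * lift2 n (VS n) (wOp n L q s ν t qh y) = K2 at key
  rw [Module.End.mul_apply, Module.End.mul_apply] at key
  have hv : opR' n q x y (vac n F) = (q*x-y) • vac n F := by
    funext a b V
    simp only [opR', opSS_apply, vac, Pi.smul_apply, smul_eq_mul]
    by_cases h1 : a = mid n <;> by_cases h2 : b = mid n <;> simp [h1, h2, rStay, rSwap]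
  rw [hv, map_smul, opR, opSS_apply, ← hK1, ← hK2, two_apply n L q s ν t qh x y b a ha,
    two_apply n L q s ν t qh x y a b hb] at key
  rw [Pi.smul_apply, Pi.smul_apply, Pi.smul_apply, mul_comm x y,
    two_apply n L q s ν t qh y x b a ha, smul_eq_mul] at key
  have hab' : a.val < b.val := hab
  simp only [rStay, rSwap, hab', not_lt_of_gt hab', if_true, if_false] at key
  rw [mul_comm x y]
  exact key


/-- displacement along a Γ row -/
def dlG (n L : ℕ) (p : Fin (L+1) → Col n) : VS n := ∑ c : Fin L, sg n c (p c.succ) (p c.castSucc)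
/-- displacement along a Δ row -/
def dlD (n L : ℕ) (p : Fin (L+1) → Col n) : VS n := ∑ c : Fin L, sg n c (p c.castSucc) (p c.succ)

noncomputable def pG (n L : ℕ) (q s x : ℂ) (p : Fin (L+1) → Col n) (V : VS n) : ℂ :=
  ∏ c : Fin L, gw n q s x (V c) (p c.succ) (p c.castSucc)
noncomputable def pD (n L : ℕ) (q s x : ℂ) (p : Fin (L+1) → Col n) (V : VS n) : ℂ :=
  ∏ c : Fin L, dw n q s x (V c) (p c.castSucc) (p c.succ)

lemma dlG_apply (n L : ℕ) (p : Fin (L+1) → Col n) (c : Fin L) :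
    dlG n L p c = eZ n (p c.succ) - eZ n (p c.castSucc) := by
  simp only [dlG, Finset.sum_apply, sg]
  rw [Finset.sum_eq_single c]
  · simp
  · intro b _ hb
    exact Pi.single_eq_of_ne (fun h => hb (Fin.ext h.symm)) _
  · simp
lemma dlD_apply (n L : ℕ) (p : Fin (L+1) → Col n) (c : Fin L) :
    dlD n L p c = eZ n (p c.castSucc) - eZ n (p c.succ) := by
  simp only [dlD, Finset.sum_apply, sg]
  rw [Finset.sum_eq_single c]
  · simp
  · intro b _ hb
    exact Pi.single_eq_of_ne (fun h => hb (Fin.ext h.symm)) _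
  · simp
lemma dlD_out (n L : ℕ) (p : Fin (L+1) → Col n) (c : ℕ) (hc : L ≤ c) :
    dlD n L p c = 0 := by
  simp only [dlD, Finset.sum_apply, sg]
  refine Finset.sum_eq_zero fun b _ => Pi.single_eq_of_ne ?_ _
  have := b.isLt; omega

lemma sum_snoc (n m : ℕ) (f : (Fin (m+2) → Col n) → ℂ) :
    ∑ p, f p = ∑ l : Col n, ∑ p : Fin (m+1) → Col n, f (Fin.snoc (α := fun _ => Col n) p l) := by
  rw [← Fintype.sum_prod_type']
  exact (Fintype.sum_equiv (Fin.snocEquiv fun _ => Col n) _ _ fun _ => rfl).symm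

lemma dlG_snoc (n m : ℕ) (p : Fin (m+1) → Col n) (l : Col n) :
    dlG n (m+1) (Fin.snoc (α := fun _ => Col n) p l) = dlG n m p + sg n m l (p (Fin.last m)) := by
  simp only [dlG, Fin.sum_univ_castSucc, Fin.snoc_castSucc, Fin.succ_last, Fin.snoc_last,
    Fin.val_castSucc, Fin.val_last, ← Fin.castSucc_succ]
lemma dlD_snoc (n m : ℕ) (p : Fin (m+1) → Col n) (l : Col n) :
    dlD n (m+1) (Fin.snoc (α := fun _ => Col n) p l) = dlD n m p + sg n m (p (Fin.last m)) l := by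
  simp only [dlD, Fin.sum_univ_castSucc, Fin.snoc_castSucc, Fin.succ_last, Fin.snoc_last,
    Fin.val_castSucc, Fin.val_last, ← Fin.castSucc_succ]
lemma pG_snoc (n m : ℕ) (q s x : ℂ) (p : Fin (m+1) → Col n) (l : Col n) (V : VS n) :
    pG n (m+1) q s x (Fin.snoc (α := fun _ => Col n) p l) V
      = pG n m q s x p V * gw n q s x (V m) l (p (Fin.last m)) := by
  simp only [pG, Fin.prod_univ_castSucc, Fin.snoc_castSucc, Fin.succ_last, Fin.snoc_last,
    Fin.val_castSucc, Fin.val_last, ← Fin.castSucc_succ]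
lemma pD_snoc (n m : ℕ) (q s x : ℂ) (p : Fin (m+1) → Col n) (l : Col n) (V : VS n) :
    pD n (m+1) q s x (Fin.snoc (α := fun _ => Col n) p l) V
      = pD n m q s x p V * dw n q s x (V m) (p (Fin.last m)) l := by
  simp only [pD, Fin.prod_univ_castSucc, Fin.snoc_castSucc, Fin.succ_last, Fin.snoc_last,
    Fin.val_castSucc, Fin.val_last, ← Fin.castSucc_succ]

lemma pG_sg (n m : ℕ) (q s x : ℂ) (p : Fin (m+1) → Col n) (a l : Col n) (V : VS n) :
    pG n m q s x p (V + sg n m a l) = pG n m q s x p V := by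
  refine Finset.prod_congr rfl fun c _ => ?_
  rw [sg_diff n m c (by have := c.isLt; omega)]

lemma gRow_sum (n : ℕ) (q s x : ℂ) (m : ℕ) (Φ : Fn1 n (VS n)) (a : Col n) (V : VS n) :
    gRow n q s x m Φ a V = ∑ p : Fin (m+1) → Col n,
      if p (Fin.last m) = a then pG n m q s x p V * Φ (p 0) (V + dlG n m p) else 0 := by
  induction m generalizing a V with
  | zero =>
    rw [Fintype.sum_equiv (Equiv.funUnique (Fin 1) (Col n)) _
      (fun b => if b = a then Φ b V else 0)]
    · simp [gRow]
    · intro p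
      have e : (Equiv.funUnique (Fin 1) (Col n)) p = p 0 := rfl
      have e2 : p (Fin.last 0) = p 0 := rfl
      rw [e, e2]
      simp [pG, dlG]
  | succ m ih =>
    rw [sum_snoc]
    rw [gRow, Module.End.mul_apply, gOp, rOp_apply]
    simp only [Fin.snoc_last, pG_snoc, dlG_snoc]
    have hR := Finset.sum_eq_single (s := Finset.univ) (f := fun l => ∑ p : Fin (m+1) → Col n,
      if l = a then pG n m q s x p V * gw n q s x (V m) l (p (Fin.last m)) *
        Φ ((Fin.snoc (α := fun _ => Col n) p l : Fin (m+2) → Col n) 0)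
          (V + (dlG n m p + sg n m l (p (Fin.last m)))) else 0) a
      (by intro b _ hb; simp [hb]) (by simp)
    rw [hR]
    simp only [if_true, ih, pG_sg, Finset.mul_sum, mul_ite, mul_zero]
    rw [Finset.sum_comm]
    refine Finset.sum_congr rfl fun p _ => ?_
    rw [Finset.sum_ite_eq]
    simp only [Finset.mem_univ, if_true]
    have : (Fin.snoc (α := fun _ => Col n) p a : Fin (m+2) → Col n) 0 = p 0 := by
      have := Fin.snoc_castSucc (α := fun _ => Col n) a p 0
      simpa using this
    rw [this, add_assoc V, add_comm (sg n m a _)]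
    ring

lemma dRow_sum (n : ℕ) (q s x : ℂ) (m : ℕ) (Φ : Fn1 n (VS n)) (a : Col n) (V : VS n) :
    dRow n q s x m Φ a V = ∑ p : Fin (m+1) → Col n,
      if p 0 = a then pD n m q s x p V * Φ (p (Fin.last m)) (V + dlD n m p) else 0 := by
  induction m generalizing Φ with
  | zero =>
    rw [Fintype.sum_equiv (Equiv.funUnique (Fin 1) (Col n)) _
      (fun b => if b = a then Φ b V else 0)]
    · simp [dRow]
    · intro p
      have e : (Equiv.funUnique (Fin 1) (Col n)) p = p 0 := rfl
      have e2 : p (Fin.last 0) = p 0 := rfl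
      rw [e, e2]
      simp [pD, dlD]
  | succ m ih =>
    rw [sum_snoc]
    rw [dRow, Module.End.mul_apply, ih]
    simp only [Fin.snoc_last, pD_snoc, dlD_snoc, dOp, rOp_apply]
    rw [Finset.sum_comm]
    refine Finset.sum_congr rfl fun p _ => ?_
    have : ∀ b, (Fin.snoc (α := fun _ => Col n) p b : Fin (m+2) → Col n) 0 = p 0 := by
      intro b
      have := Fin.snoc_castSucc (α := fun _ => Col n) b p 0
      simpa using this
    simp only [this]
    by_cases h : p 0 = a
    · simp only [h, if_true, Finset.mul_sum]
      refine Finset.sum_congr rfl fun l _ => ?_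
      rw [Pi.add_apply, dlD_out n m p m le_rfl, add_zero, add_assoc]; ring
    · simp [h]

lemma capOp_sum (n : ℕ) (ν t qh x : ℂ) (Φ : Fn1 n (VS n)) (a : Col n) (V : VS n) :
    capOp n ν t qh x Φ a V = ∑ b, capW n ν t qh x a b * Φ b V := by
  simp only [capOp, LinearMap.add_apply, LinearMap.smul_apply, Module.End.one_apply, Pi.add_apply,
    Pi.smul_apply, smul_eq_mul, opE_apply, capW]
  generalize phiF ν t (qh * x⁻¹) = φ
  rcases lt_trichotomy a (mid n) with h | h | h
  · have hne : barC n a ≠ a := by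
      simp only [ne_eq, Fin.ext_iff, barC, Fin.lt_def, mid] at *; omega
    simp only [h, h.ne, not_lt_of_gt h, false_and, true_and, if_false, if_true]
    rw [Finset.sum_eq_add a (barC n a) hne.symm]
    · simp only [hne.symm, if_true, if_false]; ring
    · rintro b _ ⟨h1, h2⟩; simp [h1, h2]
    · simp
    · simp
  · subst h
    simp only [lt_irrefl, false_and, true_and, if_false, ite_mul, one_mul, zero_mul]
    simp
  · have hne : barC n a ≠ a := by
      simp only [ne_eq, Fin.ext_iff, barC, Fin.lt_def, mid] at *; omega
    simp only [h, h.ne', not_lt_of_gt h, false_and, true_and, if_false, if_true]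
    rw [Finset.sum_eq_add a (barC n a) hne.symm]
    · simp only [hne.symm, if_true, if_false]; ring
    · rintro b _ ⟨h1, h2⟩; simp [h1, h2]
    · simp
    · simp

/-- horizontal data of a pair of rows: the Γ row and the Δ row -/
abbrev PP (n L : ℕ) := (Fin (L+1) → Col n) × (Fin (L+1) → Col n)

/-- weight of a pair of rows with bottom configuration `V` -/
noncomputable def pW (n L : ℕ) (q s ν t qh : ℂ) (a : Col n) (x : ℂ) (p : PP n L) (V V' : VS n) : ℂ :=
  if p.1 (Fin.last L) = a ∧ p.2 (Fin.last L) = mid n then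
    pG n L q s x p.1 V * capW n ν t qh x (p.1 0) (p.2 0) * pD n L q s x p.2 V' else 0

lemma uOp_sum (n L : ℕ) (q s ν t qh : ℂ) (a : Col n) (x : ℂ) (F : VS n → ℂ) (V : VS n) :
    uOp n L q s ν t qh a x F V = ∑ p : PP n L,
      pW n L q s ν t qh a x p V (V + dlG n L p.1) * F (V + (dlD n L p.2 + dlG n L p.1)) := by
  rw [Fintype.sum_prod_type]
  simp only [uOp, wOp, Module.End.mul_apply, gRow_sum, capOp_sum, dRow_sum]
  refine Finset.sum_congr rfl fun p _ => ?_
  by_cases h : p (Fin.last L) = a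
  · simp only [h, if_true, Finset.mul_sum, pW, true_and]
    rw [Finset.sum_comm]
    refine Finset.sum_congr rfl fun p' _ => ?_
    simp only [mul_ite, mul_zero, ite_mul, zero_mul]
    rw [Finset.sum_ite_eq]
    simp only [Finset.mem_univ, if_true]
    split_ifs
    · rw [add_comm (dlD n L p'), add_assoc]; ring
    · rfl
  · simp [h, pW]


/-- iterated transfer operators -/
noncomputable def evoN (n L : ℕ) (q s ν t qh : ℂ) (f : ℕ → Col n × ℂ) (F : VS n → ℂ) :
    ℕ → VS n → ℂ
  | 0 => F
  | k+1 => uOp n L q s ν t qh (f k).1 (f k).2 (evoN n L q s ν t qh f F k)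

/-- vertical configuration at a level -/
def lv (n L k : ℕ) (hh : Fin k → PP n L) (lev : ℕ) : VS n :=
  ∑ i : Fin k, ((if lev ≤ 2 * i.val then dlD n L (hh i).2 else 0)
    + (if lev ≤ 2 * i.val + 1 then dlG n L (hh i).1 else 0))

lemma lv_snoc (n L k : ℕ) (hh : Fin k → PP n L) (p : PP n L) (lev : ℕ) :
    lv n L (k+1) (Fin.snoc (α := fun _ => PP n L) hh p) lev = lv n L k hh lev +
      ((if lev ≤ 2 * k then dlD n L p.2 else 0) + (if lev ≤ 2 * k + 1 then dlG n L p.1 else 0)) := by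
  simp only [lv, Fin.sum_univ_castSucc, Fin.snoc_castSucc, Fin.snoc_last, Fin.val_castSucc,
    Fin.val_last]

lemma lv_top (n L k : ℕ) (hh : Fin k → PP n L) (lev : ℕ) (h : 2 * k ≤ lev) :
    lv n L k hh lev = 0 := by
  refine Finset.sum_eq_zero fun i _ => ?_
  have := i.isLt
  rw [if_neg (by omega), if_neg (by omega), add_zero]

lemma lv_step (n L k : ℕ) (hh : Fin k → PP n L) (i : Fin k) :
    lv n L k hh (2*i.val+1) = lv n L k hh (2*i.val+2) + dlG n L (hh i).1 ∧
    lv n L k hh (2*i.val) = lv n L k hh (2*i.val+1) + dlD n L (hh i).2 := by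
  constructor
  · have : dlG n L (hh i).1 = ∑ j : Fin k, if j = i then dlG n L (hh j).1 else 0 := by simp
    rw [this]
    simp only [lv]
    rw [← Finset.sum_add_distrib]
    refine Finset.sum_congr rfl fun j _ => ?_
    by_cases h : j = i
    · subst h; rw [if_neg (by omega), if_pos (by omega), if_neg (by omega), if_neg (by omega), if_pos rfl]
      abel
    · have h' : j.val ≠ i.val := fun e => h (Fin.ext e)
      rw [if_neg h, add_zero]
      congr 1
      · exact if_congr (by omega) rfl rfl
      · exact if_congr (by omega) rfl rfl
  · have : dlD n L (hh i).2 = ∑ j : Fin k, if j = i then dlD n L (hh j).2 else 0 := by simp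
    rw [this]
    simp only [lv]
    rw [← Finset.sum_add_distrib]
    refine Finset.sum_congr rfl fun j _ => ?_
    by_cases h : j = i
    · subst h; rw [if_pos (by omega), if_pos (by omega), if_neg (by omega), if_pos (by omega), if_pos rfl]
      abel
    · have h' : j.val ≠ i.val := fun e => h (Fin.ext e)
      rw [if_neg h, add_zero]
      congr 1
      · exact if_congr (by omega) rfl rfl
      · exact if_congr (by omega) rfl rfl

lemma sum_snocP (A : Type) [Fintype A] (m : ℕ) (f : (Fin (m+1) → A) → ℂ) :
    ∑ p, f p = ∑ l : A, ∑ p : Fin m → A, f (Fin.snoc (α := fun _ => A) p l) := by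
  rw [← Fintype.sum_prod_type']
  exact (Fintype.sum_equiv (Fin.snocEquiv fun _ => A) _ _ fun _ => rfl).symm

lemma evoN_sum (n L : ℕ) (q s ν t qh : ℂ) (f : ℕ → Col n × ℂ) (F : VS n → ℂ) (k : ℕ) (V : VS n) :
    evoN n L q s ν t qh f F k V = ∑ hh : Fin k → PP n L,
      (∏ i : Fin k, pW n L q s ν t qh (f i).1 (f i).2 (hh i)
        (V + lv n L k hh (2*i.val+2)) (V + lv n L k hh (2*i.val+1))) * F (V + lv n L k hh 0) := by
  induction k generalizing V with
  | zero => simp [evoN, lv]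
  | succ k ih =>
    rw [evoN, uOp_sum]
    rw [sum_snocP]
    refine Finset.sum_congr rfl fun p _ => ?_
    rw [ih, Finset.mul_sum]
    refine Finset.sum_congr rfl fun hh _ => ?_
    rw [Fin.prod_univ_castSucc]
    simp only [Fin.snoc_castSucc, Fin.snoc_last, Fin.val_castSucc, Fin.val_last, lv_snoc]
    rw [lv_top n L k hh (2*k+2) (by omega), lv_top n L k hh (2*k+1) (by omega)]
    have h1 : ¬ (2*k+2 ≤ 2*k) := by omega
    have h2 : ¬ (2*k+2 ≤ 2*k+1) := by omega
    have h3 : ¬ (2*k+1 ≤ 2*k) := by omega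
    have h4 : 0 ≤ 2*k := by omega
    have h5 : 0 ≤ 2*k+1 := by omega
    simp only [h1, h2, h3, h4, h5, le_refl, if_true, if_false, add_zero, zero_add]
    have e2 : (∏ i : Fin k, pW n L q s ν t qh (f i).1 (f i).2 (hh i)
        (V + (dlD n L p.2 + dlG n L p.1) + lv n L k hh (2*i.val+2))
        (V + (dlD n L p.2 + dlG n L p.1) + lv n L k hh (2*i.val+1)))
      = ∏ i : Fin k, pW n L q s ν t qh (f i).1 (f i).2 (hh i)
        (V + (lv n L k hh (2*i.val+2) + ((if 2*i.val+2 ≤ 2*k then dlD n L p.2 else 0)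
          + (if 2*i.val+2 ≤ 2*k+1 then dlG n L p.1 else 0))))
        (V + (lv n L k hh (2*i.val+1) + ((if 2*i.val+1 ≤ 2*k then dlD n L p.2 else 0)
          + (if 2*i.val+1 ≤ 2*k+1 then dlG n L p.1 else 0)))) := by
      refine Finset.prod_congr rfl fun i _ => ?_
      have := i.isLt
      rw [if_pos (by omega), if_pos (by omega), if_pos (by omega), if_pos (by omega)]
      congr 1 <;> abel
    rw [e2]
    have e3 : V + (dlD n L p.2 + dlG n L p.1) + lv n L k hh 0
      = V + (lv n L k hh 0 + (dlD n L p.2 + dlG n L p.1)) := by abel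
    rw [e3]
    ring

lemma HH_same (n : ℕ) (q s2 : ℂ) (I : Col n → ℤ) (l : Col n) (hl : l ≠ mid n) (h : I l = 0) :
    HH n q s2 I (l.val+1) = HH n q s2 I l.val := by
  have hl' : l.val ≠ n := fun e => hl (Fin.ext e)
  unfold HH
  have e1 : (l.val + 1 ≤ n) ↔ (l.val ≤ n) := by omega
  have i1 : Finset.univ.filter (fun k : Col n => k.val < l.val + 1)
      = insert l (Finset.univ.filter (fun k : Col n => k.val < l.val)) := by
    ext k; simp [Fin.ext_iff]; omega
  have i2 : Finset.univ.filter (fun k : Col n => l.val ≤ k.val)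
      = insert l (Finset.univ.filter (fun k : Col n => l.val + 1 ≤ k.val)) := by
    ext k; simp [Fin.ext_iff]; omega
  simp only [e1]
  rw [i1, i2, Finset.sum_insert (by simp), Finset.sum_insert (by simp), h]
  simp

lemma gw_zero (n : ℕ) (q s x : ℂ) (I : Col n → ℤ) (j l : Col n) (hjl : j ≠ l) (hl : l ≠ mid n)
    (h : I l = 0) : gw n q s x I j l = 0 := by
  have hjl' : j.val ≠ l.val := fun e => hjl (Fin.ext e)
  unfold gw wG
  rw [HH_same n q _ I l hl h]
  rcases lt_or_gt_of_ne hjl' with h | h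
  · rw [if_neg (by omega), if_neg (by omega)]; simp
  · rw [if_pos (by omega), if_pos (by omega)]; simp
lemma dw_zero (n : ℕ) (q s x : ℂ) (I : Col n → ℤ) (j l : Col n) (hjl : j ≠ l) (hl : l ≠ mid n)
    (h : I l = 0) : dw n q s x I j l = 0 := by
  have hjl' : j.val ≠ l.val := fun e => hjl (Fin.ext e)
  unfold dw wD
  rw [HH_same n q _ I l hl h]
  rcases lt_or_gt_of_ne hjl' with h | h
  · rw [if_pos (by omega), if_pos (by omega)]; simp
  · rw [if_neg (by omega), if_neg (by omega)]; simp

lemma nonneg_step (n : ℕ) (I : Col n → ℤ) (hI : ∀ k, 0 ≤ I k) (j l : Col n)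
    (h : j ≠ l → l ≠ mid n → I l ≠ 0) (k : Col n) : 0 ≤ (I + (eZ n j - eZ n l)) k := by
  have hk := hI k
  simp only [Pi.add_apply, Pi.sub_apply, eZ]
  by_cases h1 : l ≠ mid n ∧ k = l
  · obtain ⟨h1, rfl⟩ := h1
    by_cases h2 : j = k
    · subst h2; simp [h1, hk]
    · have := h h2 h1
      have e : (if k ≠ mid n ∧ k = k then (1:ℤ) else 0) = 1 := if_pos ⟨h1, rfl⟩
      rw [e]; split_ifs <;> omega
  · rw [if_neg h1]; split_ifs <;> omega

lemma prod_rows (m : ℕ) (f : Fin (2*m) → ℂ) :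
    ∏ r, f r = ∏ i : Fin m, (f ⟨2*i.val, by have := i.isLt; omega⟩
      * f ⟨2*i.val+1, by have := i.isLt; omega⟩) := by
  have key : ∀ (g : ℕ → ℂ) (m : ℕ), ∏ r ∈ Finset.range (2*m), g r
      = ∏ i ∈ Finset.range m, (g (2*i) * g (2*i+1)) := by
    intro g m
    induction m with
    | zero => simp
    | succ m ih =>
      rw [show 2*(m+1) = 2*m+1+1 by ring, Finset.prod_range_succ, Finset.prod_range_succ, ih,
        Finset.prod_range_succ]; ring
  have h := key (fun r => if h : r < 2*m then f ⟨r, h⟩ else 1) m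
  rw [Finset.prod_range, Finset.prod_range] at h
  convert h using 2 with r _ i
  · simp
  · rw [dif_pos, dif_pos]


/-- row data -/
noncomputable def fR (n : ℕ) (x : Fin n → ℂ) (σ : Equiv.Perm (Col n)) : ℕ → Col n × ℂ := fun i =>
  if h : i < n then (σ (posC n ⟨i, h⟩), x ⟨i, h⟩) else (mid n, 0)

open Classical in
/-- top boundary condition as a function -/
noncomputable def topF (n L : ℕ) (μ : Fin n → ℤ) (V : VS n) : ℂ :=
  if ∀ c : Fin L, V c = castV n (topV n L μ c) then 1 else 0

/-- summand -/
noncomputable def SS (n L : ℕ) (q s ν t qh : ℂ) (x : Fin n → ℂ) (σ : Equiv.Perm (Col n))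
    (μ : Fin n → ℤ) (hh : Fin n → PP n L) : ℂ :=
  (∏ i : Fin n, pW n L q s ν t qh (σ (posC n i)) (x i) (hh i)
        (lv n L n hh (2*i.val+2)) (lv n L n hh (2*i.val+1))) * topF n L μ (lv n L n hh 0)

lemma evoN_SS (n L : ℕ) (q s ν t qh : ℂ) (x : Fin n → ℂ) (σ : Equiv.Perm (Col n))
    (μ : Fin n → ℤ) :
    evoN n L q s ν t qh (fR n x σ) (topF n L μ) n 0 = ∑ hh, SS n L q s ν t qh x σ μ hh := by
  rw [evoN_sum]
  refine Finset.sum_congr rfl fun hh _ => ?_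
  simp only [SS, zero_add]
  congr 1
  refine Finset.prod_congr rfl fun i _ => ?_
  simp [fR]

/-- compatibility of a state with row data -/
def RR (n L : ℕ) (st : St n L) (hh : Fin n → PP n L) : Prop :=
  (∀ i : Fin n, ∀ p, st.1 (⟨2*i.val+1, by have := i.isLt; omega⟩, p) = (hh i).1 p
    ∧ st.1 (⟨2*i.val, by have := i.isLt; omega⟩, p) = (hh i).2 p) ∧
  ∀ (lev : Fin (2*n+1)) (c : Fin L), castV n (st.2 (lev, c)) = lv n L n hh lev c

lemma castV_inj (n : ℕ) (I J : Vec n) (h : castV n I = castV n J) : I = J := by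
  funext k
  have := congrFun h k
  simpa [castV] using this

lemma cons_iff (n : ℕ) (I K : Vec n) (j l : Col n) :
    (∀ k, I k + eV n j k = K k + eV n l k) ↔ castV n K = castV n I + (eZ n j - eZ n l) := by
  have e : ∀ a k, (eZ n a k : ℤ) = (eV n a k : ℕ) := by
    intro a k; simp only [eZ, eV]; split_ifs <;> rfl
  constructor
  · intro h; funext k
    have := h k
    simp only [castV, Pi.add_apply, Pi.sub_apply, e]; omega
  · intro h k
    have := congrFun h k
    simp only [castV, Pi.add_apply, Pi.sub_apply, e] at this; omega

lemma BC_iff (n L : ℕ) (σ : Equiv.Perm (Col n)) (μ : Fin n → ℤ) (st : St n L)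
    (hh : Fin n → PP n L) (hR : RR n L st hh) :
    BC n L σ μ st ↔ (∀ i, (hh i).1 (Fin.last L) = σ (posC n i) ∧ (hh i).2 (Fin.last L) = mid n) ∧
      ∀ c : Fin L, lv n L n hh 0 c = castV n (topV n L μ c) := by
  obtain ⟨h1, h2⟩ := hR
  unfold BC
  constructor
  · rintro ⟨a, b, _⟩
    refine ⟨fun i => ⟨?_, ?_⟩, fun c => ?_⟩
    · rw [← (h1 i _).1, a, if_neg (by simp only; omega)]
      congr 2; ext; simp only; omega
    · rw [← (h1 i _).2, a, if_pos (by simp only; omega)]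
    · have := h2 0 c
      rw [b c] at this
      exact this.symm
  · rintro ⟨a, b⟩
    refine ⟨fun r => ?_, fun c => ?_, fun c => ?_⟩
    · have hr := r.isLt
      by_cases hp : r.val % 2 = 0
      · rw [if_pos hp]
        have := (h1 ⟨r.val/2, by omega⟩ (Fin.last L)).2
        rw [(a _).2] at this
        rw [← this]
        exact congrArg (fun z => st.1 (z, Fin.last L)) (Fin.ext (by simp only; omega))
      · rw [if_neg hp]
        have := (h1 ⟨r.val/2, by omega⟩ (Fin.last L)).1
        rw [(a _).1] at this
        rw [← this]
        exact congrArg (fun z => st.1 (z, Fin.last L)) (Fin.ext (by simp only; omega))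
    · apply castV_inj
      rw [h2 0 c]; exact b c
    · apply castV_inj
      rw [h2 _ c, lv_top n L n hh _ (by simp)]
      rfl

lemma rowD_eq (n L : ℕ) (q s : ℂ) (hq : q ≠ 0) (hs : s ≠ 0) (x : Fin n → ℂ) (st : St n L)
    (hh : Fin n → PP n L) (hR : RR n L st hh) (i : Fin n) :
    (∏ c : Fin L, MW n q s (x i)
        (st.2 (⟨2*i.val+1, by have := i.isLt; omega⟩, c))
        (st.1 (⟨2*i.val, by have := i.isLt; omega⟩, c.castSucc))
        (st.2 (⟨2*i.val, by have := i.isLt; omega⟩, c))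
        (st.1 (⟨2*i.val, by have := i.isLt; omega⟩, c.succ)))
      = pD n L q s (x i) (hh i).2 (lv n L n hh (2*i.val+1)) := by
  refine Finset.prod_congr rfl fun c _ => ?_
  obtain ⟨h1, h2⟩ := hR
  rw [MW_eq n q s _ hq hs, if_pos]
  · rw [h2, (h1 i _).2, (h1 i _).2]
  · rw [cons_iff, h2, h2, (h1 i _).2, (h1 i _).2]
    simp only
    rw [(lv_step n L n hh i).2, Pi.add_apply, dlD_apply]

lemma rowG_eq (n L : ℕ) (q s : ℂ) (hq : q ≠ 0) (hs : s ≠ 0) (x : Fin n → ℂ) (st : St n L)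
    (hh : Fin n → PP n L) (hR : RR n L st hh) (i : Fin n) :
    (∏ c : Fin L, LW n q s (x i)
        (st.2 (⟨2*i.val+2, by have := i.isLt; omega⟩, c))
        (st.1 (⟨2*i.val+1, by have := i.isLt; omega⟩, c.succ))
        (st.2 (⟨2*i.val+1, by have := i.isLt; omega⟩, c))
        (st.1 (⟨2*i.val+1, by have := i.isLt; omega⟩, c.castSucc)))
      = pG n L q s (x i) (hh i).1 (lv n L n hh (2*i.val+2)) := by
  refine Finset.prod_congr rfl fun c _ => ?_
  obtain ⟨h1, h2⟩ := hR
  rw [LW_eq n q s _ hq hs, if_pos]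
  · rw [h2, (h1 i _).1, (h1 i _).1]
  · rw [cons_iff, h2, h2, (h1 i _).1, (h1 i _).1]
    simp only
    rw [(lv_step n L n hh i).1, Pi.add_apply, dlG_apply]

lemma stWt_split (n L : ℕ) (q s ν t qh : ℂ) (x : Fin n → ℂ) (st : St n L) :
    stWt n L q s ν t qh x st = ∏ i : Fin n,
     ((∏ c : Fin L, MW n q s (x i)
        (st.2 (⟨2*i.val+1, by have := i.isLt; omega⟩, c))
        (st.1 (⟨2*i.val, by have := i.isLt; omega⟩, c.castSucc))
        (st.2 (⟨2*i.val, by have := i.isLt; omega⟩, c))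
        (st.1 (⟨2*i.val, by have := i.isLt; omega⟩, c.succ)))
      * (∏ c : Fin L, LW n q s (x i)
        (st.2 (⟨2*i.val+2, by have := i.isLt; omega⟩, c))
        (st.1 (⟨2*i.val+1, by have := i.isLt; omega⟩, c.succ))
        (st.2 (⟨2*i.val+1, by have := i.isLt; omega⟩, c))
        (st.1 (⟨2*i.val+1, by have := i.isLt; omega⟩, c.castSucc)))
      * capW n ν t qh (x i)
        (st.1 (⟨2 * i.val + 1, by have := i.isLt; omega⟩, 0))
        (st.1 (⟨2 * i.val, by have := i.isLt; omega⟩, 0))) := by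
  unfold stWt
  rw [Finset.prod_mul_distrib, prod_rows]
  congr 1
  refine Finset.prod_congr rfl fun i _ => ?_
  have e1 : 2 * i.val % 2 = 0 := by omega
  have e2 : ¬ (2 * i.val + 1) % 2 = 0 := by omega
  have e3 : ∀ h, (⟨2 * i.val / 2, h⟩ : Fin n) = i := by intro h; ext; simp only; omega
  have e4 : ∀ h, (⟨(2 * i.val + 1) / 2, h⟩ : Fin n) = i := by intro h; ext; simp only; omega
  simp only [e1, e2, if_true, if_false, e3, e4]
  rfl

open Classical in
lemma g_eq (n L : ℕ) (q s ν t qh : ℂ) (hq : q ≠ 0) (hs : s ≠ 0) (x : Fin n → ℂ)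
    (σ : Equiv.Perm (Col n)) (μ : Fin n → ℤ) (st : St n L)
    (hh : Fin n → PP n L) (hR : RR n L st hh) :
    (if BC n L σ μ st then stWt n L q s ν t qh x st else 0) = SS n L q s ν t qh x σ μ hh := by
  rw [stWt_split]
  simp only [rowD_eq n L q s hq hs x st hh hR, rowG_eq n L q s hq hs x st hh hR]
  simp only [(hR.1 _ _).1, (hR.1 _ _).2]
  rw [if_congr (BC_iff n L σ μ st hh hR) rfl rfl]
  unfold SS topF
  by_cases hA : ∀ i, (hh i).1 (Fin.last L) = σ (posC n i) ∧ (hh i).2 (Fin.last L) = mid n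
  · by_cases hB : ∀ c : Fin L, lv n L n hh 0 c = castV n (topV n L μ c)
    · rw [if_pos ⟨hA, hB⟩, if_pos hB, mul_one]
      refine Finset.prod_congr rfl fun i _ => ?_
      rw [pW, if_pos (hA i)]; ring
    · rw [if_neg (fun h => hB h.2), if_neg hB, mul_zero]
  · rw [if_neg (fun h => hA h.1)]
    push Not at hA
    obtain ⟨i, hi⟩ := hA
    rw [Finset.prod_eq_zero (Finset.mem_univ i), zero_mul]
    rw [pW, if_neg (fun h => hi h.1 h.2)]

/-- row data of a state -/
def hhO (n L : ℕ) (st : St n L) : Fin n → PP n L := fun i =>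
  (fun p => st.1 (⟨2*i.val+1, by have := i.isLt; omega⟩, p),
   fun p => st.1 (⟨2*i.val, by have := i.isLt; omega⟩, p))

/-- state of row data -/
def stO (n L : ℕ) (hh : Fin n → PP n L) : St n L :=
  (fun rp => if rp.1.val % 2 = 0 then (hh ⟨rp.1.val/2, by have := rp.1.isLt; omega⟩).2 rp.2
    else (hh ⟨rp.1.val/2, by have := rp.1.isLt; omega⟩).1 rp.2,
   fun lc k => (lv n L n hh lc.1.val lc.2.val k).toNat)

lemma level_ind (m : ℕ) (P : ℕ → Prop) (h0 : P (2*m))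
    (h1 : ∀ i : Fin m, P (2*i.val+2) → P (2*i.val+1)) (h2 : ∀ i : Fin m, P (2*i.val+1) → P (2*i.val)) :
    ∀ lev ≤ 2*m, P lev := by
  intro lev h
  obtain ⟨d, hd⟩ : ∃ d, lev + d = 2*m := ⟨2*m-lev, by omega⟩
  induction d generalizing lev with
  | zero => rw [add_zero] at hd; rw [hd]; exact h0
  | succ d ih =>
    have := ih (lev+1) (by omega) (by omega)
    rcases Nat.even_or_odd' lev with ⟨k, rfl | rfl⟩
    · exact h2 ⟨k, by omega⟩ this
    · exact h1 ⟨k, by omega⟩ this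

lemma A1 (n L : ℕ) (q s ν t qh : ℂ) (hq : q ≠ 0) (hs : s ≠ 0) (x : Fin n → ℂ)
    (σ : Equiv.Perm (Col n)) (μ : Fin n → ℤ) (st : St n L) (hB : BC n L σ μ st)
    (hw : stWt n L q s ν t qh x st ≠ 0) : RR n L st (hhO n L st) := by
  rw [stWt_split] at hw
  have hw' := fun i => Finset.prod_ne_zero_iff.mp hw i (Finset.mem_univ i)
  refine ⟨fun i p => ⟨rfl, rfl⟩, ?_⟩
  have key := level_ind n (fun lev => ∀ (h : lev < 2*n+1) (c : Fin L),
    castV n (st.2 (⟨lev, h⟩, c)) = lv n L n (hhO n L st) lev c) ?_ ?_ ?_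
  · intro lev c
    exact key lev.val (by have := lev.isLt; omega) lev.isLt c
  · intro h c
    have := hB.2.2 c
    have e : (⟨2*n, h⟩ : Fin (2*n+1)) = Fin.last (2*n) := rfl
    rw [e, this, lv_top n L n _ _ le_rfl]; rfl
  · intro i ih h c
    have := Finset.prod_ne_zero_iff.mp (right_ne_zero_of_mul (left_ne_zero_of_mul (hw' i))) c
      (Finset.mem_univ c)
    rw [LW_eq n q s _ hq hs] at this
    have h2 := (ite_ne_right_iff.mp this).1
    rw [cons_iff] at h2
    rw [h2, ih, (lv_step n L n _ i).1, Pi.add_apply, dlG_apply]; rfl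
  · intro i ih h c
    have := Finset.prod_ne_zero_iff.mp (left_ne_zero_of_mul (left_ne_zero_of_mul (hw' i))) c
      (Finset.mem_univ c)
    rw [MW_eq n q s _ hq hs] at this
    have h2 := (ite_ne_right_iff.mp this).1
    rw [cons_iff] at h2
    rw [h2, ih, (lv_step n L n _ i).2, Pi.add_apply, dlD_apply]; rfl

lemma A3 (n L : ℕ) (q s ν t qh : ℂ) (x : Fin n → ℂ)
    (σ : Equiv.Perm (Col n)) (μ : Fin n → ℤ) (hh : Fin n → PP n L)
    (hw : SS n L q s ν t qh x σ μ hh ≠ 0) :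
    ∀ lev ≤ 2*n, ∀ (c : Fin L) k, 0 ≤ lv n L n hh lev c k := by
  have hw' := fun i => Finset.prod_ne_zero_iff.mp (left_ne_zero_of_mul hw) i (Finset.mem_univ i)
  apply level_ind
  · intro c k; rw [lv_top n L n _ _ le_rfl]; rfl
  · intro i ih c k
    have := (ite_ne_right_iff.mp (hw' i)).2
    have := Finset.prod_ne_zero_iff.mp (left_ne_zero_of_mul (left_ne_zero_of_mul this)) c
      (Finset.mem_univ c)
    rw [(lv_step n L n _ i).1, Pi.add_apply, dlG_apply]
    exact nonneg_step n _ (ih c) _ _ (fun a b e => this (gw_zero n q s _ _ _ _ a b e)) k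
  · intro i ih c k
    have := (ite_ne_right_iff.mp (hw' i)).2
    have := Finset.prod_ne_zero_iff.mp (right_ne_zero_of_mul this) c
      (Finset.mem_univ c)
    rw [(lv_step n L n _ i).2, Pi.add_apply, dlD_apply]
    exact nonneg_step n _ (ih c) _ _ (fun a b e => this (dw_zero n q s _ _ _ _ a b e)) k

lemma hhO_stO (n L : ℕ) (hh : Fin n → PP n L) : hhO n L (stO n L hh) = hh := by
  funext i
  have e2 : ¬ (2 * i.val + 1) % 2 = 0 := by omega
  have e4 : ∀ h, (⟨(2 * i.val + 1) / 2, h⟩ : Fin n) = i := by intro h; ext; simp only; omega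
  ext p
  · simp only [hhO, stO, e2, if_false, e4]
  · simp [hhO, stO]

lemma stO_hhO (n L : ℕ) (st : St n L) (h : RR n L st (hhO n L st)) : stO n L (hhO n L st) = st := by
  ext rp
  · obtain ⟨r, p⟩ := rp
    simp only [stO, hhO]
    split_ifs with h
    · exact congrArg (fun z => (st.1 (z, p)).val) (Fin.ext (by simp only; omega))
    · exact congrArg (fun z => (st.1 (z, p)).val) (Fin.ext (by simp only; omega))
  · rename_i k
    obtain ⟨lev, c⟩ := rp
    simp only [stO]
    rw [← h.2]; simp [castV]

lemma RR_stO (n L : ℕ) (hh : Fin n → PP n L)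
    (h : ∀ lev ≤ 2*n, ∀ (c : Fin L) k, 0 ≤ lv n L n hh lev c k) : RR n L (stO n L hh) hh := by
  refine ⟨fun i p => ?_, fun lev c => ?_⟩
  · have := hhO_stO n L hh
    exact ⟨congrFun (congrArg Prod.fst (congrFun this i)) p,
      congrFun (congrArg Prod.snd (congrFun this i)) p⟩
  · funext k
    simp only [castV, stO]
    exact Int.toNat_of_nonneg (h lev.val (by have := lev.isLt; omega) c k)

lemma pf_evo (n L : ℕ) (q s ν t qh : ℂ) (hq : q ≠ 0) (hs : s ≠ 0) (x : Fin n → ℂ)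
    (σ : Equiv.Perm (Col n)) (μ : Fin n → ℤ) :
    pf n L q s ν t qh x σ μ = evoN n L q s ν t qh (fR n x σ) (topF n L μ) n 0 := by
  classical
  rw [evoN_SS]
  unfold pf
  have e : ∀ st, (∑ᶠ (_ : st ∈ {st : St n L | BC n L σ μ st}), stWt n L q s ν t qh x st)
      = if BC n L σ μ st then stWt n L q s ν t qh x st else 0 := by
    intro st; rw [finsum_eq_if]; rfl
  simp only [e]
  have inj : Function.Injective (stO n L) := by
    intro a b h
    rw [← hhO_stO n L a, h, hhO_stO]
  rw [finsum_eq_sum_of_support_subset (s := Finset.univ.image (stO n L))]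
  · rw [Finset.sum_image (fun a _ b _ h => inj h)]
    refine Finset.sum_congr rfl fun hh _ => ?_
    by_cases hS : SS n L q s ν t qh x σ μ hh = 0
    · by_contra hne
      rw [hS] at hne
      have h2 := ite_ne_right_iff.mp hne
      have h3 := A1 n L q s ν t qh hq hs x σ μ _ h2.1 h2.2
      rw [hhO_stO] at h3
      have h4 := g_eq n L q s ν t qh hq hs x σ μ _ _ h3
      rw [hS] at h4
      exact hne h4
    · exact g_eq n L q s ν t qh hq hs x σ μ _ _ (RR_stO n L hh (A3 n L q s ν t qh x σ μ hh hS))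
  · intro st hst
    have h2 := ite_ne_right_iff.mp (Function.mem_support.mp hst)
    have h3 := A1 n L q s ν t qh hq hs x σ μ _ h2.1 h2.2
    simp only [Finset.coe_image, Finset.coe_univ, Set.image_univ, Set.mem_range]
    exact ⟨_, stO_hhO n L st h3⟩


lemma uOp_lin (n L : ℕ) (q s ν t qh : ℂ) (a : Col n) (x : ℂ) (α β γ : ℂ) (F G H : VS n → ℂ)
    (h : ∀ V, α * F V + β * G V = γ * H V) (V : VS n) :
    α * uOp n L q s ν t qh a x F V + β * uOp n L q s ν t qh a x G V
      = γ * uOp n L q s ν t qh a x H V := by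
  simp only [uOp_sum, Finset.mul_sum]
  rw [← Finset.sum_add_distrib]
  refine Finset.sum_congr rfl fun p _ => ?_
  linear_combination (pW n L q s ν t qh a x p V (V + dlG n L p.1)) *
    h (V + (dlD n L p.2 + dlG n L p.1))

lemma evoN_congr (n L : ℕ) (q s ν t qh : ℂ) (f g : ℕ → Col n × ℂ) (F : VS n → ℂ) (k : ℕ)
    (h : ∀ j < k, f j = g j) : evoN n L q s ν t qh f F k = evoN n L q s ν t qh g F k := by
  induction k with
  | zero => rfl
  | succ k ih => rw [evoN, evoN, h k (by omega), ih (fun j hj => h j (by omega))]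

lemma evo_rec (n L : ℕ) (q s t ν qh x y : ℂ) (hq : q ≠ 0) (hs : s ≠ 0)
    (hν : ν ≠ 0) (hqh : qh ^ 2 * q = 1)
    (hx : x ≠ 0) (hy : y ≠ 0)
    (hx1 : 1 - ν * t * (qh * x⁻¹) ≠ 0) (hx2 : 1 + ν⁻¹ * (qh * x⁻¹) ≠ 0)
    (hy1 : 1 - ν * t * (qh * y⁻¹) ≠ 0) (hy2 : 1 + ν⁻¹ * (qh * y⁻¹) ≠ 0)
    (a b : Col n) (ha : a ≠ mid n) (hb : b ≠ mid n) (hab : a < b) (F : VS n → ℂ)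
    (f0 f1 f2 : ℕ → Col n × ℂ) (i : ℕ)
    (e00 : f0 i = (a, x)) (e01 : f0 (i+1) = (b, y))
    (e10 : f1 i = (b, x)) (e11 : f1 (i+1) = (a, y))
    (e20 : f2 i = (a, y)) (e21 : f2 (i+1) = (b, x))
    (h1 : ∀ j, j ≠ i → j ≠ i+1 → f1 j = f0 j) (h2 : ∀ j, j ≠ i → j ≠ i+1 → f2 j = f0 j)
    (d : ℕ) (V : VS n) :
    ((q-1)*y * sStay q (x*y) (mid n) a) * evoN n L q s ν t qh f0 F (i+2+d) V
     + (q*(x-y) * sStay q (x*y) (mid n) b) * evoN n L q s ν t qh f1 F (i+2+d) V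
     = ((q*x-y) * sStay q (x*y) (mid n) a) * evoN n L q s ν t qh f2 F (i+2+d) V := by
  induction d generalizing V with
  | zero =>
    have g1 := evoN_congr n L q s ν t qh f1 f0 F i (fun j hj => h1 j (by omega) (by omega))
    have g2 := evoN_congr n L q s ν t qh f2 f0 F i (fun j hj => h2 j (by omega) (by omega))
    have := exchange n L q s t ν qh x y hq hs hν hqh hx hy hx1 hx2 hy1 hy2 a b ha hb hab
      (evoN n L q s ν t qh f0 F i) V
    simp only [add_zero, evoN, e00, e01, e10, e11, e20, e21, g1, g2]
    linear_combination this
  | succ d ih =>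
    rw [show i+2+(d+1) = (i+2+d)+1 by ring]
    simp only [evoN]
    rw [h1 _ (by omega) (by omega), h2 _ (by omega) (by omega)]
    exact uOp_lin n L q s ν t qh _ _ _ _ _ _ _ _ ih V

lemma pf_cont (n L : ℕ) (q s ν t qh : ℂ) (hq : q ≠ 0) (hs : s ≠ 0) (X : ℂ → Fin n → ℂ) (z : ℂ)
    (hX : ∀ j, ContinuousAt (fun z => X z j) z)
    (hx0 : ∀ j, X z j ≠ 0) (hsx : ∀ j, 1 - s * X z j ≠ 0)
    (hc1 : ∀ j, 1 - ν * t * (qh * (X z j)⁻¹) ≠ 0)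
    (hc2 : ∀ j, 1 + ν⁻¹ * (qh * (X z j)⁻¹) ≠ 0)
    (σ : Equiv.Perm (Col n)) (μ : Fin n → ℤ) :
    ContinuousAt (fun z => pf n L q s ν t qh (X z) σ μ) z := by
  have e : (fun z => pf n L q s ν t qh (X z) σ μ)
      = fun z => ∑ hh, SS n L q s ν t qh (X z) σ μ hh := by
    funext z; rw [pf_evo n L q s ν t qh hq hs, evoN_SS]
  rw [e]
  have cd : ∀ j, ContinuousAt (fun z => 1 - s * X z j) z := fun j =>
    continuousAt_const.sub (continuousAt_const.mul (hX j))
  have cX : ∀ j, ContinuousAt (fun z => X z j / s) z := fun j => (hX j).div_const s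
  have cg : ∀ j I a b, ContinuousAt (fun z => gw n q s (X z j) I a b) z := by
    intro j I a b
    refine ContinuousAt.div ?_ (cd j) (hsx j)
    unfold wG
    have := cX j
    split_ifs <;> fun_prop
  have cw : ∀ j I a b, ContinuousAt (fun z => dw n q s (X z j) I a b) z := by
    intro j I a b
    refine ContinuousAt.div ?_ (cd j) (hsx j)
    unfold wD
    have := cX j
    split_ifs <;> fun_prop
  have cp : ∀ j, ContinuousAt (fun z => phiF ν t (qh * (X z j)⁻¹)) z := by
    intro j
    have ci : ContinuousAt (fun z => (X z j)⁻¹) z := (hX j).inv₀ (hx0 j)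
    unfold phiF
    refine ContinuousAt.div (by fun_prop) (by fun_prop) (mul_ne_zero (hc1 j) (hc2 j))
  have cc : ∀ j a b, ContinuousAt (fun z => capW n ν t qh (X z j) a b) z := by
    intro j a b
    have := cp j
    unfold capW
    split_ifs <;> fun_prop
  refine tendsto_finsetSum _ fun hh _ => ?_
  refine Filter.Tendsto.mul ?_ tendsto_const_nhds
  refine tendsto_finsetProd _ fun j _ => ?_
  unfold pW
  split_ifs
  · refine Filter.Tendsto.mul (Filter.Tendsto.mul ?_ (cc _ _ _)) ?_
    · exact tendsto_finsetProd _ fun c _ => cg _ _ _ _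
    · exact tendsto_finsetProd _ fun c _ => cw _ _ _ _
  · exact tendsto_const_nhds

lemma sStay_mid (n : ℕ) (q X : ℂ) (a : Col n) (ha : a ≠ mid n) :
    sStay q X (mid n) a = q ^ (if a < mid n then 1 else 0) * (1 - q * X) := by
  have ha' : a.val ≠ n := fun e => ha (Fin.ext e)
  have hv : (mid n).val = n := rfl
  simp only [sStay, Fin.lt_def, hv]
  rcases lt_or_gt_of_ne ha' with h | h
  · rw [if_pos h, if_pos h, pow_one]
  · rw [if_neg (by omega), if_pos h, if_neg (by omega), pow_zero, one_mul]

lemma cont_aux (A B C q y z0 : ℂ) (P1 P2 P3 : ℂ → ℂ) (h1 : ContinuousAt P1 z0)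
    (h2 : ContinuousAt P2 z0) (h3 : ContinuousAt P3 z0) :
    ContinuousAt (fun z => A * P1 z + q * (z - y) * B * P2 z - (q * z - y) * C * P3 z) z0 := by
  fun_prop

lemma main_generic (n L : ℕ) 
    (q s ν t qh : ℂ) (x : Fin n → ℂ)
    (hq : q ≠ 0) (hs : s ≠ 0) (hν : ν ≠ 0) (hqh : qh ^ 2 * q = 1)
    (i i' : Fin n) (hii' : (i' : ℕ) = (i : ℕ) + 1)
    (hx : x i ≠ 0) (hy : x i' ≠ 0)
    (hx1 : 1 - ν * t * (qh * (x i)⁻¹) ≠ 0) (hx2 : 1 + ν⁻¹ * (qh * (x i)⁻¹) ≠ 0)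
    (hy1 : 1 - ν * t * (qh * (x i')⁻¹) ≠ 0) (hy2 : 1 + ν⁻¹ * (qh * (x i')⁻¹) ≠ 0)
    (σ : Equiv.Perm (Col n)) (hσ : ∀ k, σ (barC n k) = barC n (σ k))
    (μ : Fin n → ℤ) 
    (hord : σ (posC n i) < σ (posC n i'))
    (hg : 1 - q * (x i * x i') ≠ 0) :
    (q-1) * x i' * q ^ (if σ (posC n i) < mid n then 1 else 0) * pf n L q s ν t qh x σ μ
     + q * (x i - x i') * q ^ (if σ (posC n i') < mid n then 1 else 0) *
        pf n L q s ν t qh x ((siB n i i').trans σ) μ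
     - (q * x i - x i') * q ^ (if σ (posC n i) < mid n then 1 else 0) *
        pf n L q s ν t qh (x ∘ Equiv.swap i i') σ μ = 0 := by
  have hm : σ (mid n) = mid n := by
    have h := hσ (mid n)
    have e : barC n (mid n) = mid n := by ext; simp [barC, mid]; omega
    rw [e] at h
    have h' := congrArg Fin.val h
    ext
    simp only [barC, mid] at h' ⊢
    omega
  have hpm : ∀ j : Fin n, σ (posC n j) ≠ mid n := by
    intro j h
    rw [← hm] at h
    have := congrArg Fin.val (σ.injective h)
    simp only [posC, mid] at this
    have := j.isLt; omega
  have hi := i.isLt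
  have hi' := i'.isLt
  have hne : i ≠ i' := fun e => by have := congrArg Fin.val e; omega
  have hpb : ∀ j k : Fin n, posC n j ≠ barC n (posC n k) := by
    intro j k h
    have := congrArg Fin.val h
    simp only [posC, barC] at this
    have := j.isLt; have := k.isLt; omega
  have hpp : ∀ j k : Fin n, j ≠ k → posC n j ≠ posC n k := by
    intro j k h e
    exact h (Fin.ext (by have := congrArg Fin.val e; simpa [posC] using this))
  have s1 : siB n i i' (posC n i) = posC n i' := by
    rw [siB, Equiv.trans_apply, Equiv.swap_apply_left,
      Equiv.swap_apply_of_ne_of_ne (hpb _ _) (hpb _ _)]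
  have s2 : siB n i i' (posC n i') = posC n i := by
    rw [siB, Equiv.trans_apply, Equiv.swap_apply_right,
      Equiv.swap_apply_of_ne_of_ne (hpb _ _) (hpb _ _)]
  have s3 : ∀ j, j ≠ i → j ≠ i' → siB n i i' (posC n j) = posC n j := by
    intro j h1 h2
    rw [siB, Equiv.trans_apply, Equiv.swap_apply_of_ne_of_ne (hpp _ _ h1) (hpp _ _ h2),
      Equiv.swap_apply_of_ne_of_ne (hpb _ _) (hpb _ _)]
  obtain ⟨d, hd⟩ : ∃ d, n = i.val + 2 + d := ⟨n - (i.val+2), by omega⟩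
  have ei' : (⟨i.val+1, by omega⟩ : Fin n) = i' := Fin.ext hii'.symm
  have key := evo_rec n L q s t ν qh (x i) (x i') hq hs hν hqh hx hy hx1 hx2 hy1 hy2
    (σ (posC n i)) (σ (posC n i')) (hpm i) (hpm i') hord (topF n L μ)
    (fR n x σ) (fR n x ((siB n i i').trans σ)) (fR n (x ∘ Equiv.swap i i') σ) i.val
    (by simp [fR]) (by rw [fR, dif_pos (by omega), ei'])
    (by simp [fR, s1]) (by rw [fR, dif_pos (by omega), ei', Equiv.trans_apply, s2])
    (by simp [fR]) (by rw [fR, dif_pos (by omega), ei']; simp)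
    (by
      intro j h1 h2
      by_cases hj : j < n
      · rw [fR, fR, dif_pos hj, dif_pos hj, Equiv.trans_apply, s3]
        · intro e; exact h1 (congrArg Fin.val e)
        · intro e; have := congrArg Fin.val e; simp only at this; omega
      · rw [fR, fR, dif_neg hj, dif_neg hj])
    (by
      intro j h1 h2
      by_cases hj : j < n
      · rw [fR, fR, dif_pos hj, dif_pos hj, Function.comp_apply, Equiv.swap_apply_of_ne_of_ne]
        · intro e; exact h1 (congrArg Fin.val e)
        · intro e; have := congrArg Fin.val e; simp only at this; omega
      · rw [fR, fR, dif_neg hj, dif_neg hj]) d 0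
  rw [← hd, ← pf_evo n L q s ν t qh hq hs, ← pf_evo n L q s ν t qh hq hs,
    ← pf_evo n L q s ν t qh hq hs, sStay_mid n q _ _ (hpm i), sStay_mid n q _ _ (hpm i')] at key
  apply mul_left_cancel₀ hg
  linear_combination key

lemma main_all (n L : ℕ) 
    (q s ν t qh : ℂ) (x : Fin n → ℂ)
    (hq : q ≠ 0) (hs : s ≠ 0) (hν : ν ≠ 0) (hqh : qh ^ 2 * q = 1)
    (hx0 : ∀ j, x j ≠ 0) (hsx : ∀ j, 1 - s * x j ≠ 0)
    (hc1 : ∀ j, 1 - ν * t * (qh * (x j)⁻¹) ≠ 0)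
    (hc2 : ∀ j, 1 + ν⁻¹ * (qh * (x j)⁻¹) ≠ 0)
    (i i' : Fin n) (hii' : (i' : ℕ) = (i : ℕ) + 1)
    (σ : Equiv.Perm (Col n)) (hσ : ∀ k, σ (barC n k) = barC n (σ k))
    (μ : Fin n → ℤ) 
    (hord : σ (posC n i) < σ (posC n i')) :
    (q-1) * x i' * q ^ (if σ (posC n i) < mid n then 1 else 0) * pf n L q s ν t qh x σ μ
     + q * (x i - x i') * q ^ (if σ (posC n i') < mid n then 1 else 0) *
        pf n L q s ν t qh x ((siB n i i').trans σ) μ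
     - (q * x i - x i') * q ^ (if σ (posC n i) < mid n then 1 else 0) *
        pf n L q s ν t qh (x ∘ Equiv.swap i i') σ μ = 0 := by
  by_cases hg : 1 - q * (x i * x i') = 0
  swap
  · exact main_generic n L q s ν t qh x hq hs hν hqh i i' hii' (hx0 _) (hx0 _) (hc1 _) (hc2 _)
      (hc1 _) (hc2 _) σ hσ μ hord hg
  have hne : i' ≠ i := fun e => by have := congrArg Fin.val e; omega
  have hcX : ∀ j, ContinuousAt (fun z => Function.update x i z j) (x i) := by
    intro j
    by_cases h : j = i
    · subst h; simp only [Function.update_self]; exact continuousAt_id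
    · simp only [Function.update_of_ne h]; exact continuousAt_const
  have hup : Function.update x i (x i) = x := Function.update_eq_self i x
  have c1 := pf_cont n L q s ν t qh hq hs (fun z => Function.update x i z) (x i) hcX
    (by simpa only [hup] using hx0) (by simpa only [hup] using hsx)
    (by simpa only [hup] using hc1) (by simpa only [hup] using hc2) σ μ
  have c2 := pf_cont n L q s ν t qh hq hs (fun z => Function.update x i z) (x i) hcX
    (by simpa only [hup] using hx0) (by simpa only [hup] using hsx)
    (by simpa only [hup] using hc1) (by simpa only [hup] using hc2) ((siB n i i').trans σ) μ
  have c3 := pf_cont n L q s ν t qh hq hs (fun z => Function.update x i z ∘ Equiv.swap i i') (x i)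
    (fun j => hcX _)
    (by simp only [hup]; exact fun j => hx0 _) (by simp only [hup]; exact fun j => hsx _)
    (by simp only [hup]; exact fun j => hc1 _) (by simp only [hup]; exact fun j => hc2 _) σ μ
  set E : ℂ → ℂ := fun z => 
    (q-1) * x i' * q ^ (if σ (posC n i) < mid n then 1 else 0) *
        pf n L q s ν t qh (Function.update x i z) σ μ
     + q * (z - x i') * q ^ (if σ (posC n i') < mid n then 1 else 0) *
        pf n L q s ν t qh (Function.update x i z) ((siB n i i').trans σ) μ
     - (q * z - x i') * q ^ (if σ (posC n i) < mid n then 1 else 0) *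
        pf n L q s ν t qh (Function.update x i z ∘ Equiv.swap i i') σ μ with hE
  have cE : ContinuousAt E (x i) := by
    rw [hE]
    exact cont_aux _ _ _ q (x i') (x i) _ _ _ c1 c2 c3
  have hfin : E (x i) = 0 := by
    have t1 : Filter.Tendsto E (nhdsWithin (x i) {x i}ᶜ) (nhds (E (x i))) :=
      cE.tendsto.mono_left nhdsWithin_le_nhds
    have ci : ContinuousAt (fun z : ℂ => z⁻¹) (x i) := continuousAt_inv₀ (hx0 i)
    have n1 : ∀ᶠ z in nhds (x i), z ≠ 0 := continuousAt_id.eventually_ne (hx0 i)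
    have n2 : ∀ᶠ z in nhds (x i), 1 - ν * t * (qh * z⁻¹) ≠ 0 :=
      ContinuousAt.eventually_ne (g := fun z => 1 - ν * t * (qh * z⁻¹)) (by fun_prop) (hc1 i)
    have n3 : ∀ᶠ z in nhds (x i), 1 + ν⁻¹ * (qh * z⁻¹) ≠ 0 :=
      ContinuousAt.eventually_ne (g := fun z => 1 + ν⁻¹ * (qh * z⁻¹)) (by fun_prop) (hc2 i)
    have t2 : E =ᶠ[nhdsWithin (x i) {x i}ᶜ] fun _ => 0 := by
      filter_upwards [nhdsWithin_le_nhds n1, nhdsWithin_le_nhds n2, nhdsWithin_le_nhds n3,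
        self_mem_nhdsWithin] with z h1 h2 h3 h4
      have hz : 1 - q * (z * x i') ≠ 0 := by
        intro h
        apply h4
        have : q * x i' * (z - x i) = 0 := by linear_combination hg - h
        rcases mul_eq_zero.mp this with h | h
        · exact absurd h (mul_ne_zero hq (hx0 _))
        · exact sub_eq_zero.mp h
      have := main_generic n L q s ν t qh (Function.update x i z) hq hs hν hqh i i' hii'
        (by simpa using h1) (by simpa [hne] using hx0 i')
        (by simpa using h2) (by simpa using h3) (by simpa [hne] using hc1 i')
        (by simpa [hne] using hc2 i') σ hσ μ hord (by simpa [hne] using hz)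
      rw [Function.update_self, Function.update_of_ne hne] at this
      exact this
    exact tendsto_nhds_unique t1 (tendsto_const_nhds.congr' t2.symm)
  simp only [hE, hup] at hfin
  exact hfin

/-- Theorem 3.2: recursion for the partition function at a
simple reflection `s_i`, `1 ≤ i ≤ n-1`; here `i, i'` are the 0-indexed
positions of the paper's `i, i+1`. -/
theorem partition_function_recursion_si (n L : ℕ) (hn : 0 < n) (hL : 0 < L)
    (q s ν t qh : ℂ) (x : Fin n → ℂ)
    (hq : q ≠ 0) (hs : s ≠ 0) (hν : ν ≠ 0) (hqh : qh ^ 2 * q = 1)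
    (hx0 : ∀ j, x j ≠ 0) (hsx : ∀ j, 1 - s * x j ≠ 0)
    (hc1 : ∀ j, 1 - ν * t * (qh * (x j)⁻¹) ≠ 0)
    (hc2 : ∀ j, 1 + ν⁻¹ * (qh * (x j)⁻¹) ≠ 0)
    (σ : Equiv.Perm (Col n)) (hσ : ∀ k, σ (barC n k) = barC n (σ k))
    (μ : Fin n → ℤ) (hμ : ∀ j, 1 ≤ |μ j| ∧ |μ j| ≤ (L : ℤ))
    (i i' : Fin n) (hii' : (i' : ℕ) = (i : ℕ) + 1)
    (hord : σ (posC n i) < σ (posC n i'))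
    (hxx : x i ≠ x i') :
    q ^ (1 + (if σ (posC n i') < mid n then 1 else 0))
        * pf n L q s ν t qh x ((siB n i i').trans σ) μ
      = ((q - 1) * x i' / (x i' - x i))
          * q ^ (if σ (posC n i) < mid n then 1 else 0)
          * pf n L q s ν t qh x σ μ
        + ((x i' - q * x i) / (x i' - x i))
          * q ^ (if σ (posC n i) < mid n then 1 else 0)
          * pf n L q s ν t qh (x ∘ Equiv.swap i i') σ μ := by
  have key := main_all n L q s ν t qh x hq hs hν hqh hx0 hsx hc1 hc2 i i' hii' σ hσ μ hord
  have hd : x i' - x i ≠ 0 := sub_ne_zero.mpr hxx.symm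
  rw [pow_add, pow_one]
  field_simp
  linear_combination -key
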